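/- Let A and B be n×n complex Hermitian matrices with A positive definite and B positive semi-definite, and let p ∈ ℕ. Then the function g(t) = Tr(((A + t·B)⁻¹)^p) is completely monotone on [0, ∞): for every k ∈ ℕ and every t ≥ 0, (-1)^k · g^(k)(t) ≥ 0. -/

import Mathlib

open Matrix
open scoped ComplexOrder

namespace BMV

open Metric Complex
open scoped Matrix.Norms.Operator

variable {ι : Type*} [Fintype ι] [DecidableEq ι]

/-- The circle integral of a function differentiable and bounded on a punctured disc vanishes. -/
lemma circleIntegral_eq_zero_of_bounded {f : ℂ → ℂ} {R δ C : ℝ} (hR : 0 < R) (hδ : 0 < δ)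
    (hf : ∀ z ∈ closedBall (0 : ℂ) R, z ≠ 0 → DifferentiableAt ℂ f z)
    (hb : ∀ z, z ≠ 0 → ‖z‖ < δ → ‖f z‖ ≤ C) : ∮ z in C(0, R), f z = 0 := by
  have key : ∀ ε, 0 < ε → ε < δ → ε ≤ R → ‖∮ z in C(0, R), f z‖ ≤ 2 * Real.pi * ε * C := by
    intro ε h0 h1 h2
    have hne : ∀ z : ℂ, z ∉ ball 0 ε → z ≠ 0 := by
      rintro z hz rfl
      exact hz (mem_ball_self h0)
    rw [circleIntegral_eq_of_differentiable_on_annulus_off_countable h0 h2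
      Set.countable_empty
      (fun z hz => (hf z hz.1 (hne z hz.2)).continuousAt.continuousWithinAt)
      (fun z hz => hf z (ball_subset_closedBall hz.1.1)
        (hne z fun h => hz.1.2 (ball_subset_closedBall h)))]
    refine circleIntegral.norm_integral_le_of_norm_le_const h0.le fun z hz => ?_
    rw [mem_sphere_zero_iff_norm] at hz
    exact hb z (by rintro rfl; simp at hz; exact h0.ne hz) (hz ▸ h1)
  have hlim : Filter.Tendsto (fun ε : ℝ => 2 * Real.pi * ε * C) (nhdsWithin 0 (Set.Ioi 0))
      (nhds (2 * Real.pi * 0 * C)) :=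
    ((Continuous.tendsto (by fun_prop) 0)).mono_left nhdsWithin_le_nhds
  have hle := ge_of_tendsto hlim (b := ‖∮ z in C(0, R), f z‖) (by
    have := Ioo_mem_nhdsGT (lt_min hδ hR)
    filter_upwards [this] with ε hε
    exact key ε hε.1 (hε.2.trans_le (min_le_left _ _)) (hε.2.le.trans (min_le_right _ _)))
  simpa using hle

/-- The Fejér-type kernel `(2 - 2 cos φ) (2 + 2 cos φ)^m` in complex form. -/
lemma kernel_nonneg (m : ℕ) {z : ℂ} (hz : ‖z‖ = 1) :
    ∃ w : ℝ, 0 ≤ w ∧ -(1 - z) ^ 2 * (1 + z) ^ (2 * m) * (z ^ (m + 1))⁻¹ = w := by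
  have hz0 : z ≠ 0 := by rintro rfl; simp at hz
  have hc : z⁻¹ = (starRingEnd ℂ) z := by
    rw [inv_def, normSq_eq_norm_sq, hz]; simp
  refine ⟨normSq (1 - z) * normSq (1 + z) ^ m,
    mul_nonneg (normSq_nonneg _) (pow_nonneg (normSq_nonneg _) _), ?_⟩
  push_cast
  rw [← mul_conj, ← mul_conj]
  simp only [map_sub, map_add, map_one, ← hc]
  have h1 : (1 - z) * (1 - z⁻¹) = -(1 - z) ^ 2 * z⁻¹ := by field_simp; ring
  have h2 : (1 + z) * (1 + z⁻¹) = (1 + z) ^ 2 * z⁻¹ := by field_simp; ring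
  rw [h1, h2, mul_pow, ← pow_mul, pow_succ z, mul_inv, inv_pow]
  ring

/-- Nonnegativity of the coefficient functional attached to the kernel. -/
lemma kernel_circleIntegral_re_nonneg (m : ℕ) {X : ℂ → ℂ} (hX : DifferentiableOn ℂ X (ball 0 1))
    (hre : ∀ z ∈ ball (0 : ℂ) 1, 0 ≤ (X z).re) :
    0 ≤ ((2 * Real.pi * I)⁻¹ *
      ∮ z in C(0, 1 / 2), X z * (-(1 - z) ^ 2 * (1 + z) ^ (2 * m)) * (z ^ (m + 2))⁻¹).re := by
  set F : ℝ → ℂ → ℂ := fun r z => X (r * z) * (-(1 - z) ^ 2 * (1 + z) ^ (2 * m)) * (z ^ (m + 2))⁻¹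
    with hF
  let clip : ℝ → ℝ := fun r => max 0 (min r 1)
  have hclip : ∀ r, 0 ≤ clip r ∧ clip r ≤ 1 := fun r =>
    ⟨le_max_left _ _, max_le zero_le_one (min_le_right _ _)⟩
  have hclipc : Continuous clip := by fun_prop
  let J : ℝ → ℂ := fun r => ∮ z in C(0, 1 / 2), F (clip r) z
  have hmem : ∀ r : ℝ, 0 ≤ r → r ≤ 1 → ∀ z : ℂ, ‖z‖ < 1 → (r : ℂ) * z ∈ ball (0 : ℂ) 1 := by
    intro r h0 h1 z hz
    rw [mem_ball_zero_iff, norm_mul, norm_real, Real.norm_of_nonneg h0]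
    nlinarith [norm_nonneg z]
  have hmem2 : ∀ r : ℝ, 0 ≤ r → r < 1 → ∀ z : ℂ, ‖z‖ ≤ 1 → (r : ℂ) * z ∈ ball (0 : ℂ) 1 := by
    intro r h0 h1 z hz
    rw [mem_ball_zero_iff, norm_mul, norm_real, Real.norm_of_nonneg h0]
    nlinarith [norm_nonneg z]
  have hJ : Continuous J := by
    apply intervalIntegral.continuous_parametric_intervalIntegral_of_continuous'
    have hz0 : ∀ x : ℝ × ℝ, circleMap 0 (1 / 2) x.2 ≠ 0 := fun x =>
      circleMap_ne_center (by norm_num)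
    have c1 : Continuous fun x : ℝ × ℝ => circleMap 0 (1 / 2) x.2 := by fun_prop
    have c2 : Continuous fun x : ℝ × ℝ => X ((clip x.1 : ℝ) * circleMap 0 (1 / 2) x.2) := by
      refine hX.continuousOn.comp_continuous (by fun_prop) fun x => ?_
      refine hmem _ (hclip _).1 (hclip _).2 _ ?_
      rw [norm_circleMap_zero]; norm_num [abs_of_pos]
    have c3 : Continuous fun x : ℝ × ℝ => ((circleMap 0 (1 / 2) x.2) ^ (m + 2))⁻¹ :=
      (c1.pow _).inv₀ fun x => pow_ne_zero _ (hz0 x)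
    simp only [Function.uncurry_def, F, deriv_circleMap, smul_eq_mul]
    exact (c1.mul continuous_const).mul ((c2.mul (by fun_prop)).mul c3)
  have hpos : ∀ r : ℝ, 0 ≤ r → r < 1 → 0 ≤ ((2 * Real.pi * I)⁻¹ * J r).re := by
    intro r h0 h1
    have hcr : clip r = r := by simp [clip, h0, h1.le]
    have hd : ∀ z : ℂ, ‖z‖ ≤ 1 → z ≠ 0 → DifferentiableAt ℂ (F r) z := by
      intro z hz hz0
      have d1 : DifferentiableAt ℂ (fun z => X (r * z)) z :=
        (hX.differentiableAt (isOpen_ball.mem_nhds (hmem2 r h0 h1 z hz))).comp z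
          (by fun_prop)
      have d2 : DifferentiableAt ℂ (fun z : ℂ => (z ^ (m + 2))⁻¹) z :=
        (by fun_prop : DifferentiableAt ℂ (fun z : ℂ => z ^ (m + 2)) z).inv (pow_ne_zero _ hz0)
      exact (d1.mul (by fun_prop)).mul d2
    have hne : ∀ z : ℂ, z ∉ ball (0 : ℂ) (1 / 2) → z ≠ 0 := by
      rintro z hz rfl
      exact hz (mem_ball_self (by norm_num))
    have heq : J r = ∮ z in C(0, 1), F r z := by
      simp only [J, hcr]
      symm
      refine circleIntegral_eq_of_differentiable_on_annulus_off_countable (by norm_num)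
        (by norm_num) Set.countable_empty
        (fun z hz => (hd z (by simpa using hz.1) (hne z hz.2)).continuousAt.continuousWithinAt)
        (fun z hz => hd z (by simpa using (ball_subset_closedBall hz.1.1))
        (hne z fun h => hz.1.2 (ball_subset_closedBall h)))
    have hI : (2 * Real.pi * I)⁻¹ * J r
        = (2 * Real.pi : ℝ)⁻¹ * ∫ θ in (0 : ℝ)..2 * Real.pi, X (r * circleMap 0 1 θ) *
          (-(1 - circleMap 0 1 θ) ^ 2 * (1 + circleMap 0 1 θ) ^ (2 * m) *
            (circleMap 0 1 θ ^ (m + 1))⁻¹) := by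
      rw [heq, circleIntegral]
      have : ∀ θ : ℝ, deriv (circleMap 0 1) θ • F r (circleMap 0 1 θ) =
          I * (X (r * circleMap 0 1 θ) *
          (-(1 - circleMap 0 1 θ) ^ 2 * (1 + circleMap 0 1 θ) ^ (2 * m) *
            (circleMap 0 1 θ ^ (m + 1))⁻¹)) := by
        intro θ
        have h0 : circleMap 0 1 θ ≠ 0 := circleMap_ne_center one_ne_zero
        simp only [deriv_circleMap, hF, smul_eq_mul]
        field_simp
        ring
      simp_rw [this]
      rw [intervalIntegral.integral_const_mul]
      push_cast
      field_simp
    rw [hI, re_ofReal_mul]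
    refine mul_nonneg (by positivity) ?_
    have hcont : Continuous fun θ : ℝ => X (r * circleMap 0 1 θ) *
          (-(1 - circleMap 0 1 θ) ^ 2 * (1 + circleMap 0 1 θ) ^ (2 * m) *
            (circleMap 0 1 θ ^ (m + 1))⁻¹) := by
      have c1 : Continuous fun x : ℝ => circleMap 0 1 x := by fun_prop
      have c2 : Continuous fun x : ℝ => X (r * circleMap 0 1 x) := by
        refine hX.continuousOn.comp_continuous (by fun_prop) fun x => ?_
        exact hmem2 r h0 h1 _ (by simp)
      have c3 : Continuous fun x : ℝ => ((circleMap 0 1 x) ^ (m + 1))⁻¹ :=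
        (c1.pow _).inv₀ fun x => pow_ne_zero _ (circleMap_ne_center one_ne_zero)
      exact c2.mul ((by fun_prop : Continuous fun θ : ℝ => -(1 - circleMap 0 1 θ) ^ 2 *
        (1 + circleMap 0 1 θ) ^ (2 * m)).mul c3)
    rw [← Complex.reCLM_apply, ← ContinuousLinearMap.intervalIntegral_comp_comm _
      (hcont.intervalIntegrable _ _)]
    refine intervalIntegral.integral_nonneg Real.two_pi_pos.le fun θ _ => ?_
    obtain ⟨w, hw, hw'⟩ := kernel_nonneg m (z := circleMap 0 1 θ) (by simp)
    rw [hw', Complex.reCLM_apply, re_mul_ofReal]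
    exact mul_nonneg (hre _ (hmem2 r h0 h1 _ (by simp))) hw
  have hlim : Filter.Tendsto (fun r => ((2 * Real.pi * I)⁻¹ * J r).re)
      (nhdsWithin 1 (Set.Iio 1)) (nhds ((2 * Real.pi * I)⁻¹ * J 1).re) :=
    (Continuous.tendsto (by fun_prop) 1).mono_left nhdsWithin_le_nhds
  have h := ge_of_tendsto hlim (b := 0) (by
    filter_upwards [Ioo_mem_nhdsLT (show (0 : ℝ) < 1 by norm_num)] with r hr
    exact hpos r hr.1.le hr.2)
  have h1 : clip 1 = 1 := by simp [clip]
  simpa [J, h1, hF] using h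

lemma kernel_circleIntegral_of_pos (m : ℕ) (hm : 1 ≤ m) :
    ∮ z in C(0, 1 / 2), (1 - z) * (1 + z) ^ (2 * m - 1) * (z ^ (m + 1))⁻¹ = 0 := by
  obtain ⟨n, rfl⟩ : ∃ n, m = n + 1 := ⟨m - 1, by omega⟩
  refine circleIntegral.integral_eq_zero_of_hasDerivWithinAt
    (f := fun z => -((n + 1 : ℕ) : ℂ)⁻¹ * ((1 + z) ^ (2 * (n + 1)) * (z ^ (n + 1))⁻¹))
    (by norm_num) fun z hz => ?_
  have hz0 : z ≠ 0 := by rintro rfl; simp at hz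
  have hn : ((n + 1 : ℕ) : ℂ) ≠ 0 := by exact_mod_cast Nat.succ_ne_zero n
  refine HasDerivAt.hasDerivWithinAt ?_
  have d1 : HasDerivAt (fun z : ℂ => (1 + z) ^ (2 * (n + 1)))
      (((2 * (n + 1) : ℕ) : ℂ) * (1 + z) ^ (2 * (n + 1) - 1) * 1) z :=
    ((hasDerivAt_id z).const_add 1).pow _
  have d2 : HasDerivAt (fun z : ℂ => (z ^ (n + 1))⁻¹) _ z :=
    (hasDerivAt_pow (n + 1) z).fun_inv (pow_ne_zero _ hz0)
  refine ((d1.mul d2).const_mul (-((n + 1 : ℕ) : ℂ)⁻¹)).congr_deriv ?_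
  have e1 : 2 * (n + 1) - 1 = 2 * n + 1 := by omega
  rw [e1]
  simp only [Nat.add_sub_cancel]
  have hn' : (n : ℂ) + 1 ≠ 0 := by exact_mod_cast hn
  push_cast
  field_simp
  ring

lemma kernel_circleIntegral_zero :
    ∮ z in C(0, 1 / 2), (1 - z) * ((1 + z) * z)⁻¹ = 2 * Real.pi * I := by
  have hne : ∀ z : ℂ, ‖z‖ ≤ 1 / 2 → 1 + z ≠ 0 := by
    intro z hz h
    rw [eq_neg_of_add_eq_zero_right h] at hz
    norm_num at hz
  have h1 : ∮ z in C(0, 1 / 2), (1 - z) * ((1 + z) * z)⁻¹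
      = ∮ z in C(0, 1 / 2), ((z - 0)⁻¹ - 2 * (1 + z)⁻¹) := by
    refine circleIntegral.integral_congr (by norm_num) fun z hz => ?_
    rw [mem_sphere_zero_iff_norm] at hz
    have h0 : z ≠ 0 := by rintro rfl; simp at hz
    have := hne z hz.le
    field_simp
    ring
  have hd : ∀ z : ℂ, ‖z‖ ≤ 1 / 2 → DifferentiableAt ℂ (fun z : ℂ => 2 * (1 + z)⁻¹) z := by
    intro z hz
    exact ((by fun_prop : DifferentiableAt ℂ (fun z : ℂ => 1 + z) z).fun_inv (hne z hz)).const_mul _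
  rw [h1, circleIntegral.integral_sub, circleIntegral.integral_sub_inv_of_mem_ball,
    circleIntegral_eq_zero_of_differentiable_on_off_countable (by norm_num)
      Set.countable_empty, sub_zero]
  · exact fun z hz => (hd z (by simpa using hz)).continuousAt.continuousWithinAt
  · exact fun z hz => hd z (by simpa using ball_subset_closedBall hz.1)
  · exact mem_ball_self (by norm_num)
  · refine ContinuousOn.circleIntegrable (by norm_num) fun z hz => ?_
    have h0 : z ≠ 0 := by rintro rfl; simp at hz
    exact ((continuousAt_id.sub continuousAt_const).inv₀ (by simpa using h0)).continuousWithinAt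
  · refine ContinuousOn.circleIntegrable (by norm_num) fun z hz => ?_
    exact (hd z (by simpa using hz.le)).continuousAt.continuousWithinAt

/-- If `X` has nonnegative real part on the unit disc, and expands near `0` as
`(1 + z) / (1 - z)` times a polynomial in the Koebe-like variable `4 z / (1 + z)^2`, then the
coefficients of that polynomial have nonpositive real part. -/
lemma re_coeff_nonpos {k : ℕ} (hk : 1 ≤ k) {X : ℂ → ℂ} {s : ℕ → ℂ} {C δ : ℝ}
    (hX : DifferentiableOn ℂ X (ball 0 1)) (hre : ∀ z ∈ ball (0 : ℂ) 1, 0 ≤ (X z).re)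
    (hδ : 0 < δ)
    (hexp : ∀ z : ℂ, ‖z‖ < δ →
      ‖X z - (1 + z) / (1 - z) * ∑ j ∈ Finset.range (k + 1), s j * (4 * z / (1 + z) ^ 2) ^ j‖
        ≤ C * ‖z‖ ^ (k + 1)) : (s k).re ≤ 0 := by
  obtain ⟨m, rfl⟩ : ∃ m, k = m + 1 := ⟨k - 1, by omega⟩
  have hp := kernel_circleIntegral_re_nonneg m hX hre
  set S : ℂ → ℂ := fun z =>
    (1 + z) / (1 - z) * ∑ j ∈ Finset.range (m + 1 + 1), s j * (4 * z / (1 + z) ^ 2) ^ j with hS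
  set K : ℂ → ℂ := fun z => (-(1 - z) ^ 2 * (1 + z) ^ (2 * m)) * (z ^ (m + 2))⁻¹ with hK
  have hne1 : ∀ z : ℂ, ‖z‖ < 1 → 1 + z ≠ 0 := by
    intro z hz h
    rw [eq_neg_of_add_eq_zero_right h] at hz
    norm_num at hz
  have hne2 : ∀ z : ℂ, ‖z‖ < 1 → 1 - z ≠ 0 := by
    intro z hz h
    rw [← sub_eq_zero.1 h] at hz
    norm_num at hz
  have dS : ∀ z : ℂ, ‖z‖ < 1 → DifferentiableAt ℂ S z := by
    intro z hz
    have d1 : DifferentiableAt ℂ (fun z : ℂ => (1 + z) / (1 - z)) z :=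
      (by fun_prop : DifferentiableAt ℂ (fun z : ℂ => 1 + z) z).fun_div (by fun_prop) (hne2 z hz)
    have d2 : DifferentiableAt ℂ (fun z : ℂ => 4 * z / (1 + z) ^ 2) z :=
      (by fun_prop : DifferentiableAt ℂ (fun z : ℂ => 4 * z) z).fun_div (by fun_prop)
        (pow_ne_zero _ (hne1 z hz))
    exact d1.mul (DifferentiableAt.fun_sum fun j _ => (d2.pow j).const_mul _)
  have dK : ∀ z : ℂ, z ≠ 0 → DifferentiableAt ℂ K z := by
    intro z hz
    have d2 : DifferentiableAt ℂ (fun z : ℂ => (z ^ (m + 2))⁻¹) z :=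
        (by fun_prop : DifferentiableAt ℂ (fun z : ℂ => z ^ (m + 2)) z).inv (pow_ne_zero _ hz)
    simp only [hK]
    fun_prop
  have dX : ∀ z : ℂ, ‖z‖ < 1 → DifferentiableAt ℂ X z := fun z hz =>
    hX.differentiableAt (isOpen_ball.mem_nhds (by simpa using hz))
  have hrem : ∮ z in C(0, 1 / 2), (X z - S z) * K z = 0 := by
    refine circleIntegral_eq_zero_of_bounded (δ := min δ 1) (C := C * (4 * 2 ^ (2 * m)))
      (by norm_num) (by positivity) ?_ ?_
    · intro z hz hz0
      have hz1 : ‖z‖ < 1 := by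
        have : ‖z‖ ≤ 1 / 2 := by simpa using hz
        linarith
      exact ((dX z hz1).sub (dS z hz1)).mul (dK z hz0)
    · intro z hz0 hz
      have hz1 : ‖z‖ < 1 := hz.trans_le (min_le_right _ _)
      have hb := hexp z (hz.trans_le (min_le_left _ _))
      have n0 : 0 < ‖z‖ := norm_pos_iff.2 hz0
      have hC : 0 ≤ C := by
        by_contra hC
        have := (norm_nonneg _).trans hb
        have : C * ‖z‖ ^ (m + 1 + 1) < 0 := mul_neg_of_neg_of_pos (not_le.1 hC) (by positivity)
        linarith
      rw [norm_mul]
      simp only [hK, norm_mul, norm_neg, norm_pow, norm_inv]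
      have n1 : ‖1 - z‖ ≤ 2 := by
        refine (norm_sub_le _ _).trans ?_
        rw [norm_one]; linarith
      have n2 : ‖1 + z‖ ≤ 2 := by
        refine (norm_add_le _ _).trans ?_
        rw [norm_one]; linarith
      calc _ ≤ (C * ‖z‖ ^ (m + 1 + 1)) * (2 ^ 2 * 2 ^ (2 * m) * (‖z‖ ^ (m + 2))⁻¹) := by
            gcongr
        _ = _ := by field_simp; norm_num
  have hsp : ∀ z ∈ sphere (0 : ℂ) (1 / 2), ‖z‖ < 1 ∧ z ≠ 0 := by
    intro z hz
    rw [mem_sphere_zero_iff_norm] at hz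
    refine ⟨by rw [hz]; norm_num, by rintro rfl; simp at hz⟩
  have hterm : ∮ z in C(0, 1 / 2), S z * K z
      = ∑ j ∈ Finset.range (m + 1 + 1), ∮ z in C(0, 1 / 2), (-(s j * 4 ^ j)) *
        (z ^ j * (1 - z) * (1 + z) ^ (2 * m + 1) * ((1 + z) ^ (2 * j))⁻¹ * (z ^ (m + 2))⁻¹) := by
    rw [← circleIntegral.integral_fun_sum]
    · refine circleIntegral.integral_congr (by norm_num) fun z hz => ?_
      obtain ⟨h1, h0⟩ := hsp z hz
      have := hne1 z h1
      have := hne2 z h1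
      simp only [hS, hK, Finset.mul_sum, Finset.sum_mul]
      refine Finset.sum_congr rfl fun j _ => ?_
      rw [div_pow, mul_pow, ← pow_mul]
      field_simp
      ring
    · intro j _
      refine ContinuousOn.circleIntegrable (by norm_num)
        fun z hz => ContinuousAt.continuousWithinAt ?_
      obtain ⟨h1, h0⟩ := hsp z hz
      have e1 : ContinuousAt (fun z : ℂ => ((1 + z) ^ (2 * j))⁻¹) z :=
        (by fun_prop : ContinuousAt (fun z : ℂ => ((1 + z) ^ (2 * j))) z).inv₀
          (pow_ne_zero _ (hne1 z h1))
      have e2 : ContinuousAt (fun z : ℂ => (z ^ (m + 2))⁻¹) z :=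
        (by fun_prop : ContinuousAt (fun z : ℂ => (z ^ (m + 2))) z).inv₀ (pow_ne_zero _ h0)
      fun_prop
  have hval : ∮ z in C(0, 1 / 2), S z * K z = -(s (m + 1) * 4 ^ (m + 1)) * (2 * Real.pi * I) := by
    rw [hterm, Finset.sum_range_succ, Finset.sum_eq_zero, zero_add,
      circleIntegral.integral_const_mul, ← kernel_circleIntegral_zero]
    · congr 1
      refine circleIntegral.integral_congr (by norm_num) fun z hz => ?_
      obtain ⟨h1, h0⟩ := hsp z hz
      have := hne1 z h1
      field_simp
      ring
    · intro j hj
      have hj : j < m + 1 := Finset.mem_range.1 hj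
      rw [circleIntegral.integral_const_mul]
      obtain ⟨i, rfl⟩ : ∃ i, m = j + i := ⟨m - j, by omega⟩
      refine mul_eq_zero_of_right _ ?_
      refine Eq.trans ?_ (kernel_circleIntegral_of_pos (i + 1) (by omega))
      refine circleIntegral.integral_congr (by norm_num) fun z hz => ?_
      obtain ⟨h1, h0⟩ := hsp z hz
      have := hne1 z h1
      have e : 2 * (i + 1) - 1 = 2 * i + 1 := by omega
      rw [e]
      field_simp
      ring
  have hXK : ∮ z in C(0, 1 / 2), X z * (-(1 - z) ^ 2 * (1 + z) ^ (2 * m)) * (z ^ (m + 2))⁻¹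
      = -(s (m + 1) * 4 ^ (m + 1)) * (2 * Real.pi * I) := by
    have hsub := circleIntegral.integral_sub (f := fun z => X z * K z) (g := fun z => S z * K z)
      (c := 0) (R := 1 / 2)
      (ContinuousOn.circleIntegrable (by norm_num) fun z hz =>
        ((dX z (hsp z hz).1).mul (dK z (hsp z hz).2)).continuousAt.continuousWithinAt)
      (ContinuousOn.circleIntegrable (by norm_num) fun z hz =>
        ((dS z (hsp z hz).1).mul (dK z (hsp z hz).2)).continuousAt.continuousWithinAt)
    simp_rw [← sub_mul] at hsub
    rw [hrem, hval] at hsub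
    simp_rw [mul_assoc (X _)]
    exact sub_eq_zero.1 hsub.symm
  rw [hXK] at hp
  have e : (2 * Real.pi * I)⁻¹ * (-(s (m + 1) * 4 ^ (m + 1)) * (2 * Real.pi * I))
      = ((-4 ^ (m + 1) : ℝ) : ℂ) * s (m + 1) := by
    have : (Real.pi : ℂ) ≠ 0 := by exact_mod_cast Real.pi_ne_zero
    push_cast
    field_simp
  rw [e, re_ofReal_mul] at hp
  have : (0 : ℝ) < 4 ^ (m + 1) := by positivity
  nlinarith

lemma eval_charpoly_eq (N : Matrix ι ι ℂ) (v : ℂ) :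
    N.charpoly.eval v = (v • (1 : Matrix ι ι ℂ) - N).det := by
  rw [Matrix.eval_charpoly, scalar_apply, Matrix.smul_one_eq_diagonal]

/-- The trace of the resolvent is the sum of the simple fractions of the eigenvalues. -/
lemma trace_resolvent (N : Matrix ι ι ℂ) {v : ℂ} (hv : ¬ N.charpoly.IsRoot v) :
    ((v • 1 - N)⁻¹).trace = (N.charpoly.roots.map fun ν => 1 / (v - ν)).sum := by
  have hev : N.charpoly.eval v ≠ 0 := hv
  rw [← Polynomial.Splits.eval_derivative_div_eval_of_ne_zero (IsAlgClosed.splits _) hev,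
    eq_div_iff hev]
  have hdet : (v • 1 - N).det ≠ 0 := by rwa [← eval_charpoly_eq]
  have hcomp : N.charpoly.comp (Polynomial.X + Polynomial.C v) =
      Polynomial.C (N.charpoly.eval v) *
        (1 + (Polynomial.X : Polynomial ℂ) • ((v • 1 - N)⁻¹).map Polynomial.C).det := by
    refine Polynomial.funext fun x => ?_
    rw [Polynomial.eval_comp, Polynomial.eval_mul, Polynomial.eval_C, eval_charpoly_eq,
      eval_charpoly_eq, ← Polynomial.coe_evalRingHom, RingHom.map_det]
    have e1 : (Polynomial.evalRingHom x).mapMatrix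
        (1 + (Polynomial.X : Polynomial ℂ) • ((v • 1 - N)⁻¹).map Polynomial.C)
        = 1 + x • (v • 1 - N)⁻¹ := by
      rw [map_add, map_one]
      congr 1
      ext i j
      simpa using mul_comm _ _
    rw [e1, ← Matrix.det_mul, mul_add, mul_one, mul_smul_comm,
      Matrix.mul_nonsing_inv _ (isUnit_iff_ne_zero.2 hdet)]
    congr 1
    simp only [Polynomial.coe_evalRingHom, Polynomial.eval_add, Polynomial.eval_X,
      Polynomial.eval_C, add_smul]
    abel
  have h1 := congrArg (fun q => Polynomial.eval 0 (Polynomial.derivative q)) hcomp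
  simp only [Polynomial.derivative_comp, Polynomial.derivative_C_mul, Polynomial.eval_mul,
    Polynomial.eval_C, Matrix.derivative_det_one_add_X_smul] at h1
  simp [Polynomial.eval_comp] at h1
  rw [h1, mul_comm]

/-- The sum, with multiplicities, of the eigenvalues in the open right half-plane. -/
noncomputable def rightSum (N : Matrix ι ι ℂ) : ℂ :=
  (N.charpoly.roots.map fun ν => if 0 < ν.re then ν else 0).sum

lemma rightSum_re_nonneg (N : Matrix ι ι ℂ) : 0 ≤ (rightSum N).re := by
  unfold rightSum
  induction N.charpoly.roots using Multiset.induction_on with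
  | empty => simp
  | cons a s ih =>
    rw [Multiset.map_cons, Multiset.sum_cons, add_re]
    refine add_nonneg ?_ ih
    split_ifs with h
    · exact h.le
    · simp

lemma circleIntegral_sum_fractions {a : ℂ} {R : ℝ} (hR : 0 < R) (s : Multiset ℂ)
    (p : ℂ → Prop) [DecidablePred p]
    (h1 : ∀ ν ∈ s, p ν → ν ∈ ball a R) (h2 : ∀ ν ∈ s, ¬ p ν → ν ∉ closedBall a R) :
    ContinuousOn (fun z => (s.map fun ν => z * (1 / (z - ν))).sum) (sphere a R) ∧
    ∮ z in C(a, R), (s.map fun ν => z * (1 / (z - ν))).sum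
      = 2 * Real.pi * I * (s.map fun ν => if p ν then ν else 0).sum := by
  induction s using Multiset.induction_on with
  | empty => simpa using ⟨continuousOn_const, by simp [circleIntegral]⟩
  | cons ν s ih =>
    obtain ⟨ih1, ih2⟩ := ih (fun x hx => h1 x (Multiset.mem_cons_of_mem hx))
      (fun x hx => h2 x (Multiset.mem_cons_of_mem hx))
    have hmem := Multiset.mem_cons_self ν s
    have hne : ∀ z ∈ sphere a R, z - ν ≠ 0 := by
      intro z hz h
      rw [sub_eq_zero] at h
      subst h
      by_cases hp : p z
      · exact (ne_of_lt (h1 z hmem hp)) hz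
      · exact h2 z hmem hp (sphere_subset_closedBall hz)
    have hi : ContinuousOn (fun z => (z - ν)⁻¹) (sphere a R) := fun z hz =>
      ((by fun_prop : ContinuousAt (fun z => z - ν) z).inv₀ (hne z hz)).continuousWithinAt
    have hc : ContinuousOn (fun z => z * (1 / (z - ν))) (sphere a R) := by
      simp only [one_div]
      exact continuousOn_id.fun_mul hi
    simp only [Multiset.map_cons, Multiset.sum_cons]
    refine ⟨hc.add ih1, ?_⟩
    rw [circleIntegral.integral_add (hc.circleIntegrable hR.le) (ih1.circleIntegrable hR.le),
      ih2, mul_add]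
    congr 1
    have e : ∮ z in C(a, R), z * (1 / (z - ν)) = ∮ z in C(a, R), (1 + ν * (z - ν)⁻¹) := by
      refine circleIntegral.integral_congr hR.le fun z hz => ?_
      have := hne z hz
      field_simp
      ring
    have e1 : ∮ _z in C(a, R), (1 : ℂ) = 0 := by
      simpa using circleIntegral.integral_sub_zpow_of_ne (n := 0) (by norm_num) a a R
    rw [e, circleIntegral.integral_add (continuousOn_const.circleIntegrable hR.le)
      ((continuousOn_const.fun_mul hi).circleIntegrable hR.le), e1,
      circleIntegral.integral_const_mul, zero_add]
    split_ifs with hp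
    · rw [circleIntegral.integral_sub_inv_of_mem_ball (h1 ν hmem hp), mul_comm]
    · have hne' : ∀ z ∈ closedBall a R, z - ν ≠ 0 := by
        intro z hz h
        rw [sub_eq_zero] at h
        exact h2 ν hmem hp (h ▸ hz)
      rw [circleIntegral_eq_zero_of_differentiable_on_off_countable hR.le Set.countable_empty
        (f := fun z => (z - ν)⁻¹), mul_zero, mul_zero]
      · exact fun z hz => ((by fun_prop : ContinuousAt (fun z => z - ν) z).inv₀
          (hne' z hz)).continuousWithinAt
      · exact fun z hz => (by fun_prop : DifferentiableAt ℂ (fun z => z - ν) z).inv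
          (hne' z (ball_subset_closedBall hz.1))

/-- The circle `C(a, R)` lies in the right half-plane, encloses all the eigenvalues of `N`
with positive real part, and `N` has no eigenvalue on the imaginary axis. -/
structure Encloses (a R : ℝ) (N : Matrix ι ι ℂ) : Prop where
  re_ne_zero : ∀ ν, N.charpoly.IsRoot ν → ν.re ≠ 0
  mem_ball : ∀ ν, N.charpoly.IsRoot ν → 0 < ν.re → ν ∈ ball (a : ℂ) R

lemma re_pos_of_mem_closedBall {a R : ℝ} (haR : R < a) {z : ℂ} (hz : z ∈ closedBall (a : ℂ) R) :
    0 < z.re := by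
  have h1 : |(z - a).re| ≤ R := (abs_re_le_norm _).trans (by simpa [dist_eq_norm] using hz)
  have h2 := (abs_le.1 h1).1
  rw [sub_re, ofReal_re] at h2
  linarith

lemma Encloses.not_isRoot {a R : ℝ} {N : Matrix ι ι ℂ} (h : Encloses a R N) (haR : R < a)
    {z : ℂ} (hz : z ∈ sphere (a : ℂ) R) : ¬ N.charpoly.IsRoot z := fun hr =>
  ne_of_lt (h.mem_ball z hr (re_pos_of_mem_closedBall haR (sphere_subset_closedBall hz))) hz

lemma Encloses.isUnit {a R : ℝ} {N : Matrix ι ι ℂ} (h : Encloses a R N) (haR : R < a)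
    {z : ℂ} (hz : z ∈ sphere (a : ℂ) R) : IsUnit (z • 1 - N) := by
  rw [Matrix.isUnit_iff_isUnit_det, isUnit_iff_ne_zero, ← eval_charpoly_eq]
  exact h.not_isRoot haR hz

lemma Encloses.circleIntegral {a R : ℝ} {N : Matrix ι ι ℂ} (h : Encloses a R N) (hR : 0 < R)
    (haR : R < a) :
    ∮ z in C(a, R), z * ((z • 1 - N)⁻¹).trace = 2 * Real.pi * I * rightSum N := by
  rw [rightSum, ← (circleIntegral_sum_fractions (a := a) hR N.charpoly.roots (fun ν => 0 < ν.re)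
    (fun ν hν hp => h.mem_ball ν (Polynomial.isRoot_of_mem_roots hν) hp)
    (fun ν hν hp hm => hp (re_pos_of_mem_closedBall haR hm))).2]
  refine circleIntegral.integral_congr hR.le fun z hz => ?_
  rw [trace_resolvent N (h.not_isRoot haR hz), Multiset.sum_map_mul_left]

/-- A uniform enclosing circle for a compact family of matrices without eigenvalues on the
imaginary axis. -/
lemma exists_encloses {K : Set ℂ} (hK : IsCompact K) {N : ℂ → Matrix ι ι ℂ}
    (hN : ContinuousOn N K) (h : ∀ z ∈ K, ∀ ν, (N z).charpoly.IsRoot ν → ν.re ≠ 0) :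
    ∃ a R : ℝ, 0 < R ∧ R < a ∧ ∀ z ∈ K, Encloses a R (N z) := by
  suffices H : ∃ a R : ℝ, 0 < R ∧ R < a ∧ ∀ z ∈ K, ∀ ν, (N z).charpoly.IsRoot ν → 0 < ν.re →
      ν ∈ ball (a : ℂ) R by
    obtain ⟨a, R, h1, h2, h3⟩ := H
    exact ⟨a, R, h1, h2, fun z hz => ⟨h z hz, h3 z hz⟩⟩
  obtain ⟨M, hM⟩ := hK.exists_bound_of_continuousOn hN
  set M' := M * ‖(1 : Matrix ι ι ℂ)‖ with hM'
  have hroot : ∀ z ∈ K, ∀ ν, (N z).charpoly.IsRoot ν → ‖ν‖ ≤ M' := by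
    intro z hz ν hν
    rw [← Matrix.mem_spectrum_iff_isRoot_charpoly] at hν
    exact (spectrum.norm_le_norm_mul_of_mem hν).trans
      (mul_le_mul_of_nonneg_right (hM z hz) (norm_nonneg _))
  set T : Set (ℂ × ℂ) := (K ×ˢ closedBall 0 M') ∩
    ((fun p : ℂ × ℂ => ((p.2 • 1 - N p.1).det, p.2.re)) ⁻¹' ({0} ×ˢ Set.Ici 0)) with hT
  have hTc : IsCompact T := by
    have hKc := hK.prod (isCompact_closedBall (0 : ℂ) M')
    refine hKc.of_isClosed_subset (ContinuousOn.preimage_isClosed_of_isClosed ?_ hKc.isClosed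
      (isClosed_singleton.prod isClosed_Ici)) Set.inter_subset_left
    have c1 : ContinuousOn (fun p : ℂ × ℂ => N p.1) (K ×ˢ closedBall (0 : ℂ) M') :=
      hN.comp continuousOn_fst fun p hp => hp.1
    have c2 : ContinuousOn (fun p : ℂ × ℂ => p.2 • (1 : Matrix ι ι ℂ) - N p.1)
        (K ×ˢ closedBall (0 : ℂ) M') := (by fun_prop : Continuous fun p : ℂ × ℂ =>
          p.2 • (1 : Matrix ι ι ℂ)).continuousOn.sub c1
    exact ((Continuous.matrix_det continuous_id).comp_continuousOn c2).prodMk (by fun_prop)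
  rcases T.eq_empty_or_nonempty with hE | hE
  · refine ⟨2, 1, one_pos, one_lt_two, fun z hz ν hν hp => ?_⟩
    have : (z, ν) ∈ T := ⟨⟨hz, by simpa using hroot z hz ν hν⟩,
      by simpa [← eval_charpoly_eq, Polynomial.IsRoot] using ⟨hν, hp.le⟩⟩
    rw [hE] at this
    exact this.elim
  · obtain ⟨p, hp, hmin⟩ := hTc.exists_isMinOn hE (f := fun p : ℂ × ℂ => p.2.re)
      (by fun_prop)
    set d := p.2.re
    have hd : 0 < d := by
      obtain ⟨⟨q1, -⟩, q2, q3⟩ := hp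
      refine lt_of_le_of_ne q3 (h p.1 q1 p.2 ?_).symm
      rw [Polynomial.IsRoot, eval_charpoly_eq]
      exact q2
    refine ⟨M' ^ 2 / d + d, M' ^ 2 / d + d / 2, by positivity, by linarith, ?_⟩
    intro z hz ν hν hpos
    have hνn := hroot z hz ν hν
    have hmem : (z, ν) ∈ T := ⟨⟨hz, by simpa using hνn⟩,
      by simpa [← eval_charpoly_eq, Polynomial.IsRoot] using ⟨hν, hpos.le⟩⟩
    have hre : d ≤ ν.re := hmin hmem
    rw [mem_ball, dist_eq_norm]
    refine lt_of_pow_lt_pow_left₀ 2 (by positivity) ?_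
    have hsq : ‖ν‖ ^ 2 ≤ M' ^ 2 := by gcongr
    rw [← normSq_eq_norm_sq, normSq_apply] at hsq ⊢
    simp only [sub_re, sub_im, ofReal_re, ofReal_im]
    have hq : M' ^ 2 / d * d = M' ^ 2 := by field_simp
    set q := M' ^ 2 / d
    have hq0 : 0 ≤ q := by positivity
    nlinarith [mul_nonneg hq0 (sub_nonneg.2 hre), mul_nonneg hd.le (sub_nonneg.2 hre)]

lemma hasDerivAt_matrix_inv {𝕜 : Type*} [NontriviallyNormedField 𝕜] [NormedAlgebra 𝕜 ℂ]
    {A : 𝕜 → Matrix ι ι ℂ} {A' : Matrix ι ι ℂ} {z : 𝕜} (hA : HasDerivAt A A' z)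
    (hu : IsUnit (A z)) :
    HasDerivAt (fun z => (A z)⁻¹) (-((A z)⁻¹ * A' * (A z)⁻¹)) z := by
  obtain ⟨u, hu⟩ := hu
  have h1 := hasFDerivAt_ringInverse (𝕜 := 𝕜) u
  rw [hu] at h1
  have h2 := h1.comp_hasDerivAt z hA
  have e : (↑u⁻¹ : Matrix ι ι ℂ) = (A z)⁻¹ := by
    rw [← hu, Matrix.coe_units_inv]
  rw [e] at h2
  simp only [Matrix.nonsing_inv_eq_ringInverse] at h2 ⊢
  exact h2

lemma continuousAt_matrix_inv {X : Type*} [TopologicalSpace X] {A : X → Matrix ι ι ℂ} {s : Set X}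
    {x : X} (hA : ContinuousWithinAt A s x) (hu : IsUnit (A x)) :
    ContinuousWithinAt (fun x => (A x)⁻¹) s x := by
  obtain ⟨u, hu⟩ := hu
  have h1 := NormedRing.inverse_continuousAt u
  rw [hu] at h1
  simp only [Matrix.nonsing_inv_eq_ringInverse]
  exact h1.comp_continuousWithinAt hA

lemma hasDerivAt_trace {ι : Type*} [Fintype ι] {𝕜 : Type*} [RCLike 𝕜] [NormedAlgebra 𝕜 ℂ]
    {A : 𝕜 → Matrix ι ι ℂ} {A' : Matrix ι ι ℂ} {z : 𝕜} (hA : HasDerivAt A A' z) :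
    HasDerivAt (fun z => (A z).trace) A'.trace z := by
  have hc : Continuous (Matrix.traceLinearMap ι 𝕜 ℂ) := by
    exact (Continuous.matrix_trace continuous_id : Continuous fun A : Matrix ι ι ℂ => A.trace)
  exact (⟨Matrix.traceLinearMap ι 𝕜 ℂ, hc⟩ : Matrix ι ι ℂ →L[𝕜] ℂ).hasFDerivAt.comp_hasDerivAt z hA

lemma hasDerivAt_circleIntegral {f f' : ℂ → ℂ → ℂ} {z₀ a : ℂ} {R ε : ℝ} (hR : 0 < R) (hε : 0 < ε)
    (hf : ∀ z ∈ closedBall z₀ ε, ContinuousOn (f z) (sphere a R))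
    (hf' : ContinuousOn (Function.uncurry f') (closedBall z₀ ε ×ˢ sphere a R))
    (hd : ∀ z ∈ closedBall z₀ ε, ∀ w ∈ sphere a R, HasDerivAt (fun z => f z w) (f' z w) z) :
    HasDerivAt (fun z => ∮ w in C(a, R), f z w) (∮ w in C(a, R), f' z₀ w) z₀ := by
  obtain ⟨C, hC⟩ :=
    ((isCompact_closedBall z₀ ε).prod (isCompact_sphere a R)).exists_bound_of_continuousOn hf'
  have hm : ∀ θ, circleMap a R θ ∈ sphere a R := fun θ => circleMap_mem_sphere a hR.le θ
  have hcont : ∀ g : ℂ → ℂ, ContinuousOn g (sphere a R) →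
      Continuous fun θ => deriv (circleMap a R) θ • g (circleMap a R θ) := by
    intro g hg
    have h1 : Continuous fun θ => g (circleMap a R θ) := hg.comp_continuous (by fun_prop) hm
    simp only [deriv_circleMap]
    exact ((continuous_circleMap 0 R).mul continuous_const).smul h1
  have hz₀ : z₀ ∈ closedBall z₀ ε := mem_closedBall_self hε.le
  have hf'0 : ContinuousOn (f' z₀) (sphere a R) :=
    hf'.comp (f := fun w => (z₀, w)) (by fun_prop) fun w hw => ⟨hz₀, hw⟩
  refine (intervalIntegral.hasDerivAt_integral_of_dominated_loc_of_deriv_le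
    (s := ball z₀ ε) (bound := fun _ => R * C)
    (F := fun z θ => deriv (circleMap a R) θ • f z (circleMap a R θ))
    (F' := fun z θ => deriv (circleMap a R) θ • f' z (circleMap a R θ))
    (ball_mem_nhds _ hε) ?_ ?_ ?_ ?_ ?_ ?_).2
  · filter_upwards [ball_mem_nhds z₀ hε] with z hz
    exact (hcont _ (hf z (ball_subset_closedBall hz))).aestronglyMeasurable
  · exact (hcont _ (hf z₀ hz₀)).intervalIntegrable _ _
  · exact (hcont _ hf'0).aestronglyMeasurable
  · refine Filter.Eventually.of_forall fun θ _ z hz => ?_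
    rw [norm_smul]
    have h1 : ‖deriv (circleMap a R) θ‖ = R := by
      simp [deriv_circleMap, abs_of_pos hR]
    rw [h1]
    exact mul_le_mul_of_nonneg_left (hC (z, circleMap a R θ) ⟨ball_subset_closedBall hz, hm θ⟩)
      hR.le
  · simp
  · refine Filter.Eventually.of_forall fun θ _ z hz => ?_
    exact (hd z (ball_subset_closedBall hz) _ (hm θ)).fun_const_smul _

/-- For a holomorphic family of matrices without eigenvalues on the imaginary axis, the sum of
the eigenvalues in the right half-plane is holomorphic. -/
lemma differentiableOn_rightSum {U : Set ℂ} (hU : IsOpen U) {N : ℂ → Matrix ι ι ℂ}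
    (hN : DifferentiableOn ℂ N U) (h : ∀ z ∈ U, ∀ ν, (N z).charpoly.IsRoot ν → ν.re ≠ 0) :
    DifferentiableOn ℂ (fun z => rightSum (N z)) U := by
  intro z₀ hz₀
  obtain ⟨ε, hε, hεU⟩ := nhds_basis_closedBall.mem_iff.1 (hU.mem_nhds hz₀)
  obtain ⟨a, R, hR, haR, henc⟩ := exists_encloses (isCompact_closedBall z₀ ε)
    (hN.continuousOn.mono hεU) (fun z hz => h z (hεU hz))
  have hpair : ContinuousOn (fun p : ℂ × ℂ => (p.2 • (1 : Matrix ι ι ℂ) - N p.1)⁻¹)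
      (closedBall z₀ ε ×ˢ sphere (a : ℂ) R) := by
    intro p hp
    refine continuousAt_matrix_inv (ContinuousWithinAt.sub ?_ ?_) ((henc p.1 hp.1).isUnit haR hp.2)
    · exact (by fun_prop : Continuous fun p : ℂ × ℂ => p.2 • (1 : Matrix ι ι ℂ)).continuousWithinAt
    · exact ((hN.continuousOn.mono hεU).comp continuousOn_fst fun p hp => hp.1) p hp
  have hderiv : ContinuousOn (fun p : ℂ × ℂ => deriv N p.1)
      (closedBall z₀ ε ×ˢ sphere (a : ℂ) R) :=
    ((hN.deriv hU).continuousOn.mono hεU).comp continuousOn_fst fun p hp => hp.1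
  have key := hasDerivAt_circleIntegral (a := a) (R := R) (ε := ε) (z₀ := z₀) hR hε
    (f := fun z w => w * ((w • 1 - N z)⁻¹).trace)
    (f' := fun z w => w * ((w • 1 - N z)⁻¹ * deriv N z * (w • 1 - N z)⁻¹).trace) ?_ ?_ ?_
  · refine (DifferentiableAt.congr_of_eventuallyEq
      (key.differentiableAt.const_mul (2 * Real.pi * I)⁻¹) ?_).differentiableWithinAt
    filter_upwards [ball_mem_nhds z₀ hε] with z hz
    rw [(henc z (ball_subset_closedBall hz)).circleIntegral hR haR]
    have : (Real.pi : ℂ) ≠ 0 := by exact_mod_cast Real.pi_ne_zero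
    field_simp
  · intro z hz
    refine continuousOn_id.fun_mul ((Continuous.matrix_trace continuous_id).comp_continuousOn
      (hpair.comp (f := fun w => (z, w)) (by fun_prop) fun w hw => ⟨hz, hw⟩))
  · exact continuousOn_snd.mul ((Continuous.matrix_trace continuous_id).comp_continuousOn
      ((hpair.mul hderiv).mul hpair))
  · intro z hz w hw
    have h1 : HasDerivAt N (deriv N z) z :=
      (hN.differentiableAt (hU.mem_nhds (hεU hz))).hasDerivAt
    have h2 := hasDerivAt_matrix_inv (h1.const_sub (w • 1)) ((henc z hz).isUnit haR hw)
    refine ((hasDerivAt_trace h2).const_mul w).congr_deriv ?_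
    simp

lemma roots_charpoly_smul (N : Matrix ι ι ℂ) {g : ℂ} (hg : g ≠ 0) :
    (g • N).charpoly.roots = N.charpoly.roots.map fun ν => g * ν := by
  have hs : N.charpoly.Splits := IsAlgClosed.splits _
  have hcard : N.charpoly.roots.card = Fintype.card ι := by
    rw [← hs.natDegree_eq_card_roots, Matrix.charpoly_natDegree_eq_dim]
  have : (g • N).charpoly =
      ((N.charpoly.roots.map fun ν => g * ν).map fun ν => Polynomial.X - Polynomial.C ν).prod := by
    refine Polynomial.funext fun x => ?_
    have h1 : x • (1 : Matrix ι ι ℂ) - g • N = g • ((g⁻¹ * x) • (1 : Matrix ι ι ℂ) - N) := by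
      rw [smul_sub, smul_smul, mul_inv_cancel_left₀ hg]
    rw [eval_charpoly_eq, h1, Matrix.det_smul, ← eval_charpoly_eq,
      hs.eval_eq_prod_roots_of_monic N.charpoly_monic, ← hcard, Polynomial.eval_multiset_prod,
      Multiset.map_map, Multiset.map_map]
    have h2 : (g ^ N.charpoly.roots.card) = (N.charpoly.roots.map fun _ => g).prod := by simp
    rw [h2, ← Multiset.prod_map_mul]
    congr 1
    refine Multiset.map_congr rfl fun ν _ => ?_
    simp only [Function.comp, Polynomial.eval_sub, Polynomial.eval_X, Polynomial.eval_C]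
    field_simp
  rw [this, Polynomial.roots_multiset_prod_X_sub_C]

lemma rightSum_smul (N : Matrix ι ι ℂ) {g : ℂ} (hg : g ≠ 0)
    (h : ∀ ν, N.charpoly.IsRoot ν → (0 < (g * ν).re ↔ 0 < ν.re)) :
    rightSum (g • N) = g * rightSum N := by
  unfold rightSum
  rw [roots_charpoly_smul N hg, Multiset.map_map, ← Multiset.sum_map_mul_left]
  congr 1
  refine Multiset.map_congr rfl fun ν hν => ?_
  simp only [Function.comp, h ν (Polynomial.isRoot_of_mem_roots hν)]
  split_ifs <;> simp

/-- An eigenvalue `ν` of `D⁻¹ * G` has an eigenvector `x` with `G x = ν D x`. -/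
lemma exists_eigenvector {D G : Matrix ι ι ℂ} (hD : IsUnit D) {ν : ℂ}
    (hν : (D⁻¹ * G).charpoly.IsRoot ν) : ∃ x : ι → ℂ, x ≠ 0 ∧
      star x ⬝ᵥ (G *ᵥ x) = ν * (star x ⬝ᵥ (D *ᵥ x)) := by
  rw [Polynomial.IsRoot, eval_charpoly_eq, ← Matrix.exists_mulVec_eq_zero_iff] at hν
  obtain ⟨x, hx, h⟩ := hν
  refine ⟨x, hx, ?_⟩
  rw [Matrix.sub_mulVec, sub_eq_zero, Matrix.smul_mulVec, Matrix.one_mulVec] at h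
  have h2 := congrArg (fun v => star x ⬝ᵥ (D *ᵥ v)) h
  simp only [Matrix.mulVec_mulVec] at h2
  rw [← mul_assoc, Matrix.mul_nonsing_inv _ ((Matrix.isUnit_iff_isUnit_det _).1 hD), one_mul,
    Matrix.mulVec_smul, dotProduct_smul, smul_eq_mul] at h2
  exact h2.symm

lemma hermitian_form_real {ι : Type*} [Fintype ι] {D : Matrix ι ι ℂ} (hD : D.IsHermitian)
    (x : ι → ℂ) :
    ∃ d : ℝ, star x ⬝ᵥ (D *ᵥ x) = d :=
  ⟨(star x ⬝ᵥ (D *ᵥ x)).re, Complex.ext rfl (by simpa using hD.im_star_dotProduct_mulVec_self x)⟩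

lemma exists_form_values {M : Matrix ι ι ℂ} (hM : M.PosSemidef) (hM' : (1 - M).PosSemidef)
    {x : ι → ℂ} (hx : x ≠ 0) : ∃ p q : ℝ, 0 ≤ p ∧ 0 ≤ q ∧ 0 < p + q ∧
      star x ⬝ᵥ (M *ᵥ x) = p ∧ star x ⬝ᵥ ((1 - M) *ᵥ x) = q := by
  obtain ⟨p, hp⟩ := hermitian_form_real hM.1 x
  obtain ⟨q, hq⟩ := hermitian_form_real hM'.1 x
  refine ⟨p, q, ?_, ?_, ?_, hp, hq⟩
  · have := hM.dotProduct_mulVec_nonneg x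
    rw [hp] at this
    exact_mod_cast this
  · have := hM'.dotProduct_mulVec_nonneg x
    rw [hq] at this
    exact_mod_cast this
  · have h1 : star x ⬝ᵥ x = ((p + q : ℝ) : ℂ) := by
      push_cast
      rw [← hp, ← hq, ← dotProduct_add, ← Matrix.add_mulVec]
      simp
    have h2 : 0 < star x ⬝ᵥ x := dotProduct_star_self_pos_iff.2 hx
    rw [h1] at h2
    exact_mod_cast h2

/-- Sign information about the eigenvalues of `D⁻¹ * (u (1 - M) + v M)`. -/
lemma exists_sign {D M : Matrix ι ι ℂ} (hD : D.IsHermitian) (hDu : IsUnit D)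
    (hM : M.PosSemidef) (hM' : (1 - M).PosSemidef) {u v ν : ℂ}
    (hν : (D⁻¹ * (u • (1 - M) + v • M)).charpoly.IsRoot ν) :
    ∃ d p q : ℝ, 0 ≤ p ∧ 0 ≤ q ∧ 0 < p + q ∧ q * u + p * v = ν * d := by
  obtain ⟨x, hx, h⟩ := exists_eigenvector hDu hν
  obtain ⟨d, hd⟩ := hermitian_form_real hD x
  obtain ⟨p, q, hp, hq, hpq, h1, h2⟩ := exists_form_values hM hM' hx
  refine ⟨d, p, q, hp, hq, hpq, ?_⟩
  rw [Matrix.add_mulVec, Matrix.smul_mulVec, Matrix.smul_mulVec, dotProduct_add,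
    dotProduct_smul, dotProduct_smul, h1, h2, hd] at h
  rw [← h]
  simp only [smul_eq_mul]
  ring

lemma re_pos_of_combination {p q : ℝ} {u v : ℂ} (hp : 0 ≤ p) (hq : 0 ≤ q) (hpq : 0 < p + q)
    (hu : 0 < u.re) (hv : 0 < v.re) : 0 < (q * u + p * v).re := by
  rw [add_re, re_ofReal_mul, re_ofReal_mul]
  rcases hp.eq_or_lt with rfl | hp
  · have : 0 < q := by linarith
    positivity
  · positivity

lemma re_ne_zero_of_isRoot {D M : Matrix ι ι ℂ} (hD : D.IsHermitian) (hDu : IsUnit D)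
    (hM : M.PosSemidef) (hM' : (1 - M).PosSemidef) {u v ν : ℂ}
    (hu : 0 < u.re) (hv : 0 < v.re)
    (hν : (D⁻¹ * (u • (1 - M) + v • M)).charpoly.IsRoot ν) : ν.re ≠ 0 := by
  obtain ⟨d, p, q, hp, hq, hpq, h⟩ := exists_sign hD hDu hM hM' hν
  have := re_pos_of_combination hp hq hpq hu hv
  rw [h, re_mul_ofReal] at this
  intro h0
  simp [h0] at this

lemma rightSum_smul_combination {D M : Matrix ι ι ℂ} (hD : D.IsHermitian) (hDu : IsUnit D)
    (hM : M.PosSemidef) (hM' : (1 - M).PosSemidef) {u v g : ℂ}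
    (hu : 0 < u.re) (hv : 0 < v.re) (hgu : 0 < (g * u).re) (hgv : 0 < (g * v).re) :
    rightSum (D⁻¹ * ((g * u) • (1 - M) + (g * v) • M)) =
      g * rightSum (D⁻¹ * (u • (1 - M) + v • M)) := by
  have hg : g ≠ 0 := by rintro rfl; simp at hgu
  rw [← rightSum_smul _ hg]
  · rw [← Matrix.mul_smul, smul_add, smul_smul, smul_smul]
  · intro ν hν
    obtain ⟨d, p, q, hp, hq, hpq, h⟩ := exists_sign hD hDu hM hM' hν
    have h1 := re_pos_of_combination hp hq hpq hu hv
    have h2 := re_pos_of_combination hp hq hpq hgu hgv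
    rw [show (q : ℂ) * (g * u) + p * (g * v) = g * ν * d by linear_combination g * h,
      re_mul_ofReal] at h2
    rw [h, re_mul_ofReal] at h1
    rcases lt_trichotomy d 0 with hd | rfl | hd
    · exact ⟨fun h => by nlinarith, fun h => by nlinarith⟩
    · simp at h1
    · exact ⟨fun _ => pos_of_mul_pos_left h1 hd.le, fun _ => pos_of_mul_pos_left h2 hd.le⟩

lemma hasDerivAt_trace_pow {𝕜 : Type*} [RCLike 𝕜] [NormedAlgebra 𝕜 ℂ]
    {A : 𝕜 → Matrix ι ι ℂ} {A' : Matrix ι ι ℂ} {z : 𝕜} (hA : HasDerivAt A A' z) (k : ℕ) :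
    HasDerivAt (fun z => (A z ^ k).trace) (k * (A z ^ (k - 1) * A').trace) z := by
  refine (hasDerivAt_trace (hA.fun_pow' k)).congr_deriv ?_
  rw [Matrix.trace_sum, ← Finset.card_range k, ← nsmul_eq_mul, ← Finset.sum_const,
    Finset.card_range]
  refine Finset.sum_congr rfl fun i hi => ?_
  have hi := Finset.mem_range.1 hi
  rw [Matrix.trace_mul_cycle, ← pow_add]
  congr 3
  simp only [Nat.pred_eq_sub_one]
  omega

/-- Finite geometric expansion of the inverse of `Y₀ (1 - κ T)`. -/
lemma inv_expansion {Y₀ Y T : Matrix ι ι ℂ} {κ : ℂ} (h₀ : IsUnit Y₀) (hY : IsUnit Y)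
    (h : Y = Y₀ * (1 - κ • T)) (n : ℕ) :
    Y⁻¹ = ∑ j ∈ Finset.range n, κ ^ j • (T ^ j * Y₀⁻¹) + κ ^ n • (T ^ n * Y⁻¹) := by
  have hd₀ := (Matrix.isUnit_iff_isUnit_det _).1 h₀
  have hd := (Matrix.isUnit_iff_isUnit_det _).1 hY
  have hstep : Y⁻¹ = Y₀⁻¹ + κ • (T * Y⁻¹) := by
    have h1 : Y₀⁻¹ * Y = 1 - κ • T := by
      rw [h, ← mul_assoc, Matrix.nonsing_inv_mul _ hd₀, one_mul]
    have h2 : Y₀⁻¹ = (1 - κ • T) * Y⁻¹ := by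
      rw [← h1, mul_assoc, Matrix.mul_nonsing_inv _ hd, mul_one]
    rw [h2, sub_mul, one_mul, smul_mul_assoc]
    abel
  induction n with
  | zero => simp
  | succ n ih =>
    rw [Finset.sum_range_succ, add_assoc]
    convert ih using 2
    conv_rhs => rw [hstep]
    rw [mul_add, smul_add, Matrix.mul_smul, smul_smul, ← mul_assoc, ← pow_succ, ← pow_succ]

/-- Expansion of the sum of the right eigenvalues of `D⁻¹ (1 - κ M)` in powers of `κ`. -/
lemma rightSum_expansion {D M : Matrix ι ι ℂ} (hDu : IsUnit D) {a R : ℝ}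
    (hR : 0 < R) (haR : R < a)
    (henc : ∀ κ ∈ closedBall (0 : ℂ) (1 / 2),
      Encloses a R (D⁻¹ * ((1 : ℂ) • (1 - M) + (1 - κ) • M))) (n : ℕ) :
    (∀ w ∈ sphere (a : ℂ) R, IsUnit (1 - w • D)) ∧
    ∃ (s : ℕ → ℂ) (C : ℝ),
      (∀ j : ℕ, 2 * Real.pi * I * (j * s j) = ∮ w in C(a, R), (((1 - w • D)⁻¹ * M) ^ j).trace) ∧
      ∀ κ ∈ closedBall (0 : ℂ) (1 / 2),
        ‖rightSum (D⁻¹ * ((1 : ℂ) • (1 - M) + (1 - κ) • M)) - ∑ j ∈ Finset.range n, s j * κ ^ j‖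
          ≤ C * ‖κ‖ ^ n := by
  have hpi : (2 * Real.pi * I : ℂ) ≠ 0 := Complex.two_pi_I_ne_zero
  have hDd := (Matrix.isUnit_iff_isUnit_det _).1 hDu
  set N : ℂ → Matrix ι ι ℂ := fun κ => D⁻¹ * ((1 : ℂ) • (1 - M) + (1 - κ) • M) with hN
  have hN0 : N 0 = D⁻¹ := by simp [hN]
  have hNκ : ∀ κ, N κ = D⁻¹ - κ • (D⁻¹ * M) := by
    intro κ
    simp only [hN, one_smul, sub_smul, Matrix.mul_add, Matrix.mul_sub, Matrix.mul_smul, mul_one]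
    abel
  have h0mem : (0 : ℂ) ∈ closedBall (0 : ℂ) (1 / 2) := mem_closedBall_self (by norm_num)
  have hY₀ : ∀ w ∈ sphere (a : ℂ) R, IsUnit (w • (1 : Matrix ι ι ℂ) - D⁻¹) := by
    intro w hw
    have := (henc 0 h0mem).isUnit haR hw
    rwa [← hN0]
  have hfac : ∀ w : ℂ, 1 - w • D = -((w • (1 : Matrix ι ι ℂ) - D⁻¹) * D) := by
    intro w
    rw [sub_mul, smul_mul_assoc, one_mul, Matrix.nonsing_inv_mul _ hDd]
    abel
  have hunit : ∀ w ∈ sphere (a : ℂ) R, IsUnit (1 - w • D) := by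
    intro w hw
    rw [hfac]
    exact ((hY₀ w hw).mul hDu).neg
  refine ⟨hunit, ?_⟩
  set T : ℂ → Matrix ι ι ℂ := fun w => (1 - w • D)⁻¹ * M with hT
  have hrel : ∀ w ∈ sphere (a : ℂ) R, ∀ κ,
      w • 1 - N κ = (w • (1 : Matrix ι ι ℂ) - D⁻¹) * (1 - κ • T w) := by
    intro w hw κ
    have h1 : (w • (1 : Matrix ι ι ℂ) - D⁻¹) = -((1 - w • D) * D⁻¹) := by
      rw [hfac, neg_mul, neg_neg, mul_assoc, Matrix.mul_nonsing_inv _ hDd, mul_one]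
    have h2 : (w • (1 : Matrix ι ι ℂ) - D⁻¹) = -(D⁻¹ * (1 - w • D)) := by
      rw [mul_sub, Matrix.mul_smul, Matrix.nonsing_inv_mul _ hDd, mul_one]
      abel
    have h3 : (w • (1 : Matrix ι ι ℂ) - D⁻¹) * T w = -(D⁻¹ * M) := by
      rw [h2, hT, neg_mul, mul_assoc, ← mul_assoc (1 - w • D), Matrix.mul_nonsing_inv _
        ((Matrix.isUnit_iff_isUnit_det _).1 (hunit w hw)), one_mul]
    rw [mul_sub, mul_one, Matrix.mul_smul, h3, hNκ]
    simp only [smul_neg, sub_neg_eq_add]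
    abel
  have hTd : ∀ w ∈ sphere (a : ℂ) R,
      HasDerivAt T (-((w • (1 : Matrix ι ι ℂ) - D⁻¹)⁻¹ * T w)) w := by
    intro w hw
    have h1 : HasDerivAt (fun w : ℂ => 1 - w • D) (-D) w := by
      exact (((hasDerivAt_id w).smul_const D).const_sub 1).congr_deriv (by rw [one_smul])
    refine ((hasDerivAt_matrix_inv h1 (hunit w hw)).mul_const M).congr_deriv ?_
    have h2 : (w • (1 : Matrix ι ι ℂ) - D⁻¹)⁻¹ = -((1 - w • D)⁻¹ * D) := by
      refine Matrix.inv_eq_left_inv ?_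
      have h2 : (w • (1 : Matrix ι ι ℂ) - D⁻¹) = -(D⁻¹ * (1 - w • D)) := by
        rw [mul_sub, Matrix.mul_smul, Matrix.nonsing_inv_mul _ hDd, mul_one]
        abel
      rw [h2, neg_mul_neg, mul_assoc, ← mul_assoc D, Matrix.mul_nonsing_inv _ hDd, one_mul,
        Matrix.nonsing_inv_mul _ ((Matrix.isUnit_iff_isUnit_det _).1 (hunit w hw))]
    rw [h2, hT]
    simp only [neg_mul, mul_neg, neg_neg, mul_assoc]
  have cT : ContinuousOn T (sphere (a : ℂ) R) := fun w hw =>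
    (hTd w hw).continuousAt.continuousWithinAt
  have cY₀ : ContinuousOn (fun w : ℂ => (w • (1 : Matrix ι ι ℂ) - D⁻¹)⁻¹) (sphere (a : ℂ) R) :=
    fun w hw => continuousAt_matrix_inv (by fun_prop) (hY₀ w hw)
  have ctr : Continuous fun A : Matrix ι ι ℂ => A.trace := Continuous.matrix_trace continuous_id
  have cterm : ∀ j : ℕ, ContinuousOn
      (fun w : ℂ => w * (T w ^ j * (w • (1 : Matrix ι ι ℂ) - D⁻¹)⁻¹).trace) (sphere (a : ℂ) R) :=
    fun j => continuousOn_id.fun_mul (ctr.comp_continuousOn ((cT.pow j).mul cY₀))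
  have cY : ContinuousOn (fun p : ℂ × ℂ => (p.2 • (1 : Matrix ι ι ℂ) - N p.1)⁻¹)
      (closedBall 0 (1 / 2) ×ˢ sphere (a : ℂ) R) := fun p hp =>
    continuousAt_matrix_inv (by simp only [hNκ]; fun_prop) ((henc p.1 hp.1).isUnit haR hp.2)
  have crem : ContinuousOn (fun p : ℂ × ℂ => p.2 * (T p.2 ^ n *
      (p.2 • (1 : Matrix ι ι ℂ) - N p.1)⁻¹).trace) (closedBall 0 (1 / 2) ×ˢ sphere (a : ℂ) R) :=
    continuousOn_snd.mul (ctr.comp_continuousOn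
      (((cT.comp continuousOn_snd fun p hp => hp.2).pow n).mul cY))
  obtain ⟨C, hC⟩ := ((isCompact_closedBall (0 : ℂ) (1 / 2)).prod
    (isCompact_sphere (a : ℂ) R)).exists_bound_of_continuousOn crem
  refine ⟨fun j => (2 * Real.pi * I)⁻¹ *
    ∮ w in C(a, R), w * (T w ^ j * (w • (1 : Matrix ι ι ℂ) - D⁻¹)⁻¹).trace, R * C, ?_, ?_⟩
  · intro j
    have h1 : ∮ w in C(a, R), ((T w ^ j).trace -
        j * (w * (T w ^ j * (w • (1 : Matrix ι ι ℂ) - D⁻¹)⁻¹).trace)) = 0 := by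
      refine circleIntegral.integral_eq_zero_of_hasDerivWithinAt
        (f := fun w => w * (T w ^ j).trace) hR.le fun w hw => HasDerivAt.hasDerivWithinAt ?_
      refine ((hasDerivAt_id w).fun_mul (hasDerivAt_trace_pow (hTd w hw) j)).congr_deriv ?_
      rcases j with _ | j
      · simp
      · have e : (T w ^ j * ((w • (1 : Matrix ι ι ℂ) - D⁻¹)⁻¹ * T w)).trace =
            (T w ^ (j + 1) * (w • (1 : Matrix ι ι ℂ) - D⁻¹)⁻¹).trace := by
          rw [← mul_assoc, Matrix.trace_mul_cycle, pow_succ']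
        simp only [id, Nat.add_sub_cancel, mul_neg, Matrix.trace_neg, e]
        ring
    rw [circleIntegral.integral_sub, circleIntegral.integral_const_mul, sub_eq_zero] at h1
    · rw [h1]
      field_simp
    · exact (ctr.comp_continuousOn (cT.pow j)).circleIntegrable hR.le
    · exact (continuousOn_const.fun_mul (cterm j)).circleIntegrable hR.le
  · intro κ hκ
    have hsum : 2 * Real.pi * I * rightSum (N κ) =
        (∑ j ∈ Finset.range n, κ ^ j *
          ∮ w in C(a, R), w * (T w ^ j * (w • (1 : Matrix ι ι ℂ) - D⁻¹)⁻¹).trace) +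
        κ ^ n * ∮ w in C(a, R), w * (T w ^ n * (w • (1 : Matrix ι ι ℂ) - N κ)⁻¹).trace := by
      rw [← (henc κ hκ).circleIntegral hR haR]
      simp only [← circleIntegral.integral_const_mul]
      rw [← circleIntegral.integral_fun_sum, ← circleIntegral.integral_add]
      · refine circleIntegral.integral_congr hR.le fun w hw => ?_
        refine (congrArg (fun Q : Matrix ι ι ℂ => w * Q.trace) (inv_expansion (hY₀ w hw)
          ((henc κ hκ).isUnit haR hw) (hrel w hw κ) n)).trans ?_
        generalize (w • 1 - N κ)⁻¹ = Q
        simp only [Matrix.trace_add, Matrix.trace_sum, Matrix.trace_smul, smul_eq_mul, mul_add,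
          Finset.mul_sum]
        congr 1
        · exact Finset.sum_congr rfl fun j _ => by ring
        · ring
      · exact (continuousOn_finsetSum _ fun j _ =>
          continuousOn_const.fun_mul (cterm j)).circleIntegrable hR.le
      · refine (continuousOn_const.fun_mul ?_).circleIntegrable hR.le
        exact crem.comp (f := fun w => (κ, w)) (by fun_prop) fun w hw => ⟨hκ, hw⟩
      · exact fun j _ => (continuousOn_const.fun_mul (cterm j)).circleIntegrable hR.le
    have hdiff : rightSum (N κ) - ∑ j ∈ Finset.range n, (2 * Real.pi * I)⁻¹ *
        (∮ w in C(a, R), w * (T w ^ j * (w • (1 : Matrix ι ι ℂ) - D⁻¹)⁻¹).trace) * κ ^ j =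
        κ ^ n * ((2 * Real.pi * I)⁻¹ *
          ∮ w in C(a, R), w * (T w ^ n * (w • (1 : Matrix ι ι ℂ) - N κ)⁻¹).trace) := by
      have h1 : rightSum (N κ) = (2 * Real.pi * I)⁻¹ * (2 * Real.pi * I * rightSum (N κ)) := by
        rw [inv_mul_cancel_left₀ hpi]
      rw [h1, hsum, mul_add, Finset.mul_sum, add_sub_right_comm, ← Finset.sum_sub_distrib,
        Finset.sum_eq_zero fun j _ => by ring, zero_add]
      ring
    rw [hdiff, norm_mul, norm_pow, mul_comm]
    refine mul_le_mul_of_nonneg_right ?_ (by positivity)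
    rw [← smul_eq_mul]
    exact circleIntegral.norm_two_pi_i_inv_smul_integral_le_of_norm_le_const hR.le
      fun w hw => hC (κ, w) ⟨hκ, hw⟩

/-- Positivity of the contour integral of `tr ([(1 - w D)⁻¹ M]^k)` around the positive poles. -/
lemma exists_circle_integral_re_nonpos {D M : Matrix ι ι ℂ} (hD : D.IsHermitian) (hDu : IsUnit D)
    (hM : M.PosSemidef) (hM' : (1 - M).PosSemidef) {k : ℕ} (hk : 1 ≤ k) :
    ∃ a R : ℝ, 0 < R ∧ R < a ∧ Encloses a R D⁻¹ ∧
      ((2 * Real.pi * I)⁻¹ *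
        ∮ w in C(a, R), (((1 - w • D)⁻¹ * M) ^ k).trace).re ≤ 0 := by
  have hvpos : ∀ κ ∈ closedBall (0 : ℂ) (1 / 2), 0 < (1 - κ).re := by
    intro κ hκ
    have h1 := (abs_le.1 ((abs_re_le_norm κ).trans (by simpa using hκ : ‖κ‖ ≤ 1 / 2))).2
    rw [sub_re, one_re]
    linarith
  obtain ⟨a, R, hR, haR, henc⟩ := exists_encloses (isCompact_closedBall (0 : ℂ) (1 / 2))
    (N := fun κ => D⁻¹ * ((1 : ℂ) • (1 - M) + (1 - κ) • M)) (by fun_prop)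
    (fun κ hκ ν hν => re_ne_zero_of_isRoot hD hDu hM hM' (by simp) (hvpos κ hκ) hν)
  obtain ⟨-, s, C, hs, hexp⟩ := rightSum_expansion hDu hR haR henc (k + 1)
  refine ⟨a, R, hR, haR, ?_, ?_⟩
  · have := henc 0 (mem_closedBall_self (by norm_num))
    simpa using this
  rw [← hs k, inv_mul_cancel_left₀ Complex.two_pi_I_ne_zero]
  suffices h : (s k).re ≤ 0 by
    have := mul_nonpos_of_nonneg_of_nonpos (Nat.cast_nonneg k : (0 : ℝ) ≤ k) h
    simpa using this
  have hne1 : ∀ z : ℂ, ‖z‖ < 1 → 1 + z ≠ 0 := by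
    intro z hz h
    rw [eq_neg_of_add_eq_zero_right h] at hz
    norm_num at hz
  have hne2 : ∀ z : ℂ, ‖z‖ < 1 → 1 - z ≠ 0 := by
    intro z hz h
    rw [← sub_eq_zero.1 h] at hz
    norm_num at hz
  have hgre : ∀ z : ℂ, ‖z‖ < 1 → 0 < ((1 + z) / (1 - z)).re := by
    intro z hz
    have h1 : 0 < normSq (1 - z) := normSq_pos.2 (hne2 z hz)
    have h2 : normSq z < 1 := by
      rw [normSq_eq_norm_sq]; nlinarith [norm_nonneg z]
    rw [div_re, ← add_div]
    refine div_pos ?_ h1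
    rw [normSq_apply] at h2
    simp
    nlinarith
  have hgre' : ∀ z : ℂ, ‖z‖ < 1 → 0 < ((1 - z) / (1 + z)).re := by
    intro z hz
    have := hgre (-z) (by simpa using hz)
    simpa [sub_eq_add_neg] using this
  set X : ℂ → ℂ := fun z =>
    rightSum (D⁻¹ * (((1 + z) / (1 - z)) • (1 - M) + ((1 - z) / (1 + z)) • M)) with hX
  refine re_coeff_nonpos hk (X := X) (C := 4 * (C * 16 ^ (k + 1))) (δ := 1 / 32)
    ?_ (fun z _ => rightSum_re_nonneg _) (by norm_num) ?_
  · refine differentiableOn_rightSum isOpen_ball ?_ ?_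
    · intro z hz
      rw [mem_ball_zero_iff] at hz
      have d1 : DifferentiableAt ℂ (fun z : ℂ => (1 + z) / (1 - z)) z :=
        (by fun_prop : DifferentiableAt ℂ (fun z : ℂ => 1 + z) z).fun_div (by fun_prop) (hne2 z hz)
      have d2 : DifferentiableAt ℂ (fun z : ℂ => (1 - z) / (1 + z)) z :=
        (by fun_prop : DifferentiableAt ℂ (fun z : ℂ => 1 - z) z).fun_div (by fun_prop) (hne1 z hz)
      exact (((d1.smul_const (1 - M)).add (d2.smul_const M)).const_mul
        D⁻¹).differentiableWithinAt
    · intro z hz ν hν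
      rw [mem_ball_zero_iff] at hz
      exact re_ne_zero_of_isRoot hD hDu hM hM' (hgre z hz) (hgre' z hz) hν
  · intro z hz
    have hz1 : ‖z‖ < 1 := by linarith
    have n1 : 1 / 2 ≤ ‖1 + z‖ := by
      have := norm_sub_le (1 + z) z
      rw [add_sub_cancel_right, norm_one] at this
      linarith
    have n2 : 1 / 2 ≤ ‖1 - z‖ := by
      have := norm_add_le (1 - z) z
      rw [sub_add_cancel, norm_one] at this
      linarith
    have n3 : ‖1 + z‖ ≤ 2 := by
      refine (norm_add_le _ _).trans ?_
      rw [norm_one]; linarith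
    set κ := 4 * z / (1 + z) ^ 2 with hκ
    set g := (1 + z) / (1 - z) with hg
    have nκ : ‖κ‖ ≤ 16 * ‖z‖ := by
      rw [hκ, norm_div, norm_mul, norm_pow, div_le_iff₀ (by positivity)]
      have : (1 / 2) ^ 2 ≤ ‖1 + z‖ ^ 2 := by gcongr
      norm_num at this ⊢
      nlinarith [norm_nonneg z]
    have ng : ‖g‖ ≤ 4 := by
      rw [hg, norm_div, div_le_iff₀ (by positivity)]
      linarith
    have hκm : κ ∈ closedBall (0 : ℂ) (1 / 2) := by
      rw [mem_closedBall_zero_iff]; linarith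
    have hgκ : g * (1 - κ) = (1 - z) / (1 + z) := by
      have := hne1 z hz1
      have := hne2 z hz1
      rw [hg, hκ]
      field_simp
      ring
    have hXeq : X z = g * rightSum (D⁻¹ * ((1 : ℂ) • (1 - M) + (1 - κ) • M)) := by
      rw [← rightSum_smul_combination hD hDu hM hM' (by simp) (hvpos κ hκm)
        (by rw [mul_one]; exact hgre z hz1) (by rw [hgκ]; exact hgre' z hz1), hgκ, mul_one]
    have hCnn : 0 ≤ C * ‖κ‖ ^ (k + 1) := (norm_nonneg _).trans (hexp κ hκm)
    rw [hXeq, ← mul_sub, norm_mul]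
    rcases eq_or_ne z 0 with rfl | hz0
    · have h0 := hexp κ hκm
      have : κ = 0 := by simp [hκ]
      rw [this] at h0 ⊢
      simp only [norm_zero] at h0 ⊢
      have h1 : (0 : ℝ) ^ (k + 1) = 0 := by simp
      rw [h1, mul_zero] at h0 ⊢
      rw [le_antisymm h0 (norm_nonneg _), mul_zero]
    · have hκ0 : κ ≠ 0 := div_ne_zero (mul_ne_zero (by norm_num) hz0) (pow_ne_zero _ (hne1 z hz1))
      have hC0 : 0 ≤ C := nonneg_of_mul_nonneg_left hCnn (by positivity)
      calc _ ≤ 4 * (C * ‖κ‖ ^ (k + 1)) :=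
            mul_le_mul ng (hexp κ hκm) (norm_nonneg _) (by norm_num)
        _ ≤ 4 * (C * (16 * ‖z‖) ^ (k + 1)) := by gcongr
        _ = _ := by rw [mul_pow]; ring

section PartialFractions

variable {R : Type*} [CommRing R] [Algebra ℂ R]

/-- The span of the simple fractions `y i ^ m`, `1 ≤ m ≤ k`. -/
def fractionSpan (y : ι → R) (k : ℕ) : Submodule ℂ R :=
  Submodule.span ℂ (Set.range fun p : ι × Fin k => y p.1 ^ (p.2 + 1 : ℕ))

lemma pow_mem_fractionSpan {ι : Type*} (y : ι → R) {k m : ℕ} (i : ι) (hm : m < k) :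
    y i ^ (m + 1) ∈ fractionSpan y k :=
  Submodule.subset_span ⟨(i, ⟨m, hm⟩), rfl⟩

lemma fractionSpan_mono {ι : Type*} (y : ι → R) {k l : ℕ} (h : k ≤ l) :
    fractionSpan y k ≤ fractionSpan y l := by
  refine Submodule.span_le.2 ?_
  rintro _ ⟨⟨i, m⟩, rfl⟩
  exact pow_mem_fractionSpan y i (m.2.trans_le h)

lemma mul_pow_mem_fractionSpan {ι : Type*} {y : ι → R} {d : ι → ℂ}
    (hy : ∀ i j, y i - y j = (d j - d i) • (y i * y j)) {i j : ι} (hij : d i ≠ d j) (m : ℕ) :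
    y i * y j ^ (m + 1) ∈ fractionSpan y (m + 1) := by
  have hne : d j - d i ≠ 0 := sub_ne_zero.2 hij.symm
  have key : y i * y j = (d j - d i)⁻¹ • (y i - y j) := by
    rw [hy i j, smul_smul, inv_mul_cancel₀ hne, one_smul]
  have hstep : ∀ m, y i * y j ^ (m + 1) = (d j - d i)⁻¹ • (y i * y j ^ m - y j ^ (m + 1)) := by
    intro m
    rw [pow_succ', ← mul_assoc, key, smul_mul_assoc, sub_mul]
  induction m with
  | zero =>
    rw [hstep, pow_zero, mul_one]
    refine Submodule.smul_mem _ _ (Submodule.sub_mem _ ?_ (pow_mem_fractionSpan y j one_pos))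
    simpa using pow_mem_fractionSpan y i (m := 0) one_pos
  | succ m ih =>
    rw [hstep]
    exact Submodule.smul_mem _ _ (Submodule.sub_mem _ (fractionSpan_mono y (Nat.le_succ _) ih)
      (pow_mem_fractionSpan y j (Nat.lt_succ_self _)))

lemma mul_mem_fractionSpan {ι : Type*} {y : ι → R} {d : ι → ℂ}
    (hy : ∀ i j, y i - y j = (d j - d i) • (y i * y j)) (i : ι) {k : ℕ} {r : R}
    (hr : r ∈ fractionSpan y k) : y i * r ∈ fractionSpan y (k + 1) := by
  induction hr using Submodule.span_induction with
  | mem r hr =>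
    obtain ⟨⟨j, m⟩, rfl⟩ := hr
    by_cases hij : d i = d j
    · have : y i = y j := by
        have := hy i j
        rwa [hij, sub_self, zero_smul, sub_eq_zero] at this
      simp only [this, ← pow_succ']
      exact pow_mem_fractionSpan y j (by omega)
    · exact fractionSpan_mono y (by omega) (mul_pow_mem_fractionSpan hy hij m)
  | zero => simp
  | add r s _ _ hr hs => rw [mul_add]; exact Submodule.add_mem _ hr hs
  | smul c r _ hr => rw [mul_smul_comm]; exact Submodule.smul_mem _ _ hr

/-- The diagonal projection onto the coordinates where `d` takes the value `α`. -/
noncomputable def levelProj (d : ι → ℂ) (α : ℂ) : Matrix ι ι ℂ := by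
  classical exact diagonal fun i => if d i = α then 1 else 0

lemma levelProj_mul_pow_apply (d : ι → ℂ) (α : ℂ) (B : Matrix ι ι ℂ) (k : ℕ) (i j : ι) :
    ((levelProj d α * B) ^ (k + 1)) i j =
      if d i = α then ∑ l, B i l * ((levelProj d α * B) ^ k) l j else 0 := by
  rw [pow_succ', mul_assoc, levelProj, diagonal_mul, mul_apply]
  split_ifs <;> simp

lemma pow_apply_sub_mem_fractionSpan {y : ι → R} {d : ι → ℂ}
    (hy : ∀ i j, y i - y j = (d j - d i) • (y i * y j)) (B : Matrix ι ι ℂ) (k : ℕ) (i j : ι) :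
    ((diagonal y * B.map (algebraMap ℂ R)) ^ (k + 1)) i j -
      ((levelProj d (d i) * B) ^ (k + 1)) i j • y i ^ (k + 1) ∈ fractionSpan y k := by
  induction k generalizing i j with
  | zero =>
    simp [levelProj, Algebra.smul_def, mul_comm]
  | succ k ih =>
    rw [pow_succ', mul_assoc, diagonal_mul, mul_apply, levelProj_mul_pow_apply, if_pos rfl,
      Finset.sum_smul, Finset.mul_sum, ← Finset.sum_sub_distrib]
    refine Submodule.sum_mem _ fun l _ => ?_
    have h1 := Submodule.smul_mem _ (B i l) (mul_mem_fractionSpan hy i (ih l j))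
    by_cases hil : d i = d l
    · have : y i = y l := by
        have := hy i l
        rwa [hil, sub_self, zero_smul, sub_eq_zero] at this
      convert h1 using 1
      rw [← hil, this, map_apply, mul_sub, smul_sub, mul_smul_comm, ← pow_succ', smul_smul,
        ← Algebra.smul_def, mul_smul_comm]
    · have h2 := Submodule.smul_mem _ (B i l * ((levelProj d (d l) * B) ^ (k + 1)) l j)
        (mul_pow_mem_fractionSpan hy hil k)
      convert Submodule.add_mem _ h1 h2 using 1
      rw [levelProj_mul_pow_apply d (d i), if_neg (Ne.symm hil), mul_zero, zero_smul, sub_zero,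
        map_apply, mul_sub, smul_sub, mul_smul_comm, smul_smul, sub_add_cancel,
        ← Algebra.smul_def, mul_smul_comm]

/-- Partial fraction decomposition of `tr ((diag y · B)^(k + 2))`. -/
lemma exists_partial_fractions {y : ι → R} {d : ι → ℂ}
    (hy : ∀ i j, y i - y j = (d j - d i) • (y i * y j)) (B : Matrix ι ι ℂ) (k : ℕ) :
    ∃ ρ : ι → Fin k → ℂ, ((diagonal y * B.map (algebraMap ℂ R)) ^ (k + 1)).trace =
      ∑ i, (((levelProj d (d i) * B) ^ (k + 1)) i i • y i ^ (k + 1) +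
        ∑ m, ρ i m • y i ^ (m + 1 : ℕ)) := by
  have h : ((diagonal y * B.map (algebraMap ℂ R)) ^ (k + 1)).trace -
      ∑ i, ((levelProj d (d i) * B) ^ (k + 1)) i i • y i ^ (k + 1) ∈ fractionSpan y k := by
    rw [trace, ← Finset.sum_sub_distrib]
    exact Submodule.sum_mem _ fun i _ => pow_apply_sub_mem_fractionSpan hy B k i i
  obtain ⟨ρ, hρ⟩ := (Submodule.mem_span_range_iff_exists_fun ℂ).1 h
  refine ⟨fun i m => ρ (i, m), ?_⟩
  rw [Finset.sum_add_distrib, ← sub_eq_iff_eq_add', ← hρ, Fintype.sum_prod_type]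

end PartialFractions

/-- The diagonal coefficients of the highest-order fractions are non-negative. -/
lemma levelProj_mul_pow_apply_re_nonneg (d : ι → ℂ) {B : Matrix ι ι ℂ} (hB : B.PosSemidef)
    (k : ℕ) (i : ι) : 0 ≤ (((levelProj d (d i) * B) ^ k) i i).re := by
  set P := levelProj d (d i) with hP
  have hPP : P * P = P := by
    rw [hP, levelProj, diagonal_mul_diagonal]
    congr 1
    ext j
    split_ifs <;> simp
  have hPH : Pᴴ = P := by
    rw [hP, levelProj, diagonal_conjTranspose]
    congr 1
    ext j
    simp only [Pi.star_apply]
    split_ifs <;> simp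
  have h1 : (P * B) ^ k * P = P * (P * B * P) ^ k := by
    induction k with
    | zero => simp
    | succ k ih =>
      rw [pow_succ', mul_assoc, ih, pow_succ', ← mul_assoc, ← mul_assoc, ← mul_assoc P,
        ← mul_assoc P,
        hPP]
  have h2 : ((P * B) ^ k) i i = ((P * B * P) ^ k) i i := by
    have h3 := congrFun (congrFun h1 i) i
    rw [hP, levelProj, mul_diagonal, diagonal_mul] at h3
    simpa [hP, levelProj] using h3
  rw [h2]
  have h4 : (P * B * P).PosSemidef := by
    have := hB.conjTranspose_mul_mul_same P
    rwa [hPH] at this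
  exact (Complex.le_def.1 (h4.pow k).diag_nonneg).1

lemma circleIntegral_eq_zero_of_no_pole {a R : ℝ} (hR : 0 < R) (haR : R < a) {l : ℂ}
    (hl : ∀ z ∈ closedBall (a : ℂ) R, 1 - z * l ≠ 0) (m p : ℕ) :
    ∮ z in C(a, R), z⁻¹ ^ p * (1 - z * l)⁻¹ ^ m = 0 := by
  have hd : ∀ z ∈ closedBall (a : ℂ) R,
      DifferentiableAt ℂ (fun z : ℂ => z⁻¹ ^ p * (1 - z * l)⁻¹ ^ m) z := by
    intro z hz
    have hz0 : z ≠ 0 := by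
      rintro rfl
      simpa using re_pos_of_mem_closedBall haR hz
    have h1 : DifferentiableAt ℂ (fun z : ℂ => 1 - z * l) z := by fun_prop
    exact (differentiableAt_id.fun_inv hz0).fun_pow p |>.fun_mul ((h1.fun_inv (hl z hz)).fun_pow m)
  exact circleIntegral_eq_zero_of_differentiable_on_off_countable hR.le Set.countable_empty
    (fun z hz => (hd z hz).continuousAt.continuousWithinAt)
    fun z hz => hd z (ball_subset_closedBall hz.1)

lemma circleIntegrable_kernel {a R : ℝ} (hR : 0 < R) (haR : R < a) {l : ℂ}
    (hl : ∀ z ∈ sphere (a : ℂ) R, 1 - z * l ≠ 0) (m p : ℕ) :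
    CircleIntegrable (fun z => z⁻¹ ^ p * (1 - z * l)⁻¹ ^ m) a R := by
  have h0 : ∀ z ∈ sphere (a : ℂ) R, z ≠ 0 := by
    rintro z hz rfl
    simpa using re_pos_of_mem_closedBall haR (sphere_subset_closedBall hz)
  exact (((continuousOn_id.inv₀ h0).pow p).mul
    (((by fun_prop : ContinuousOn (fun z : ℂ => 1 - z * l) _).inv₀ hl).pow m)).circleIntegrable
    hR.le

lemma circleIntegral_kernel_zero {a R : ℝ} {l : ℂ} (hl0 : l ≠ 0)
    (hl : l⁻¹ ∈ ball (a : ℂ) R) (m : ℕ) :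
    ∮ z in C(a, R), (1 - z * l)⁻¹ ^ m = if m = 1 then -(2 * Real.pi * I) * l⁻¹ else 0 := by
  have h1 : ∀ z : ℂ, (1 - z * l)⁻¹ ^ m = (-l)⁻¹ ^ m * (z - l⁻¹)⁻¹ ^ m := by
    intro z
    rw [← mul_pow, ← mul_inv]
    congr 2
    field_simp
    ring
  simp only [h1, circleIntegral.integral_const_mul]
  split_ifs with hm
  · simp only [hm, pow_one]
    rw [circleIntegral.integral_sub_inv_of_mem_ball hl, inv_neg]
    ring
  · have h2 : ∀ z : ℂ, (z - l⁻¹)⁻¹ ^ m = (z - l⁻¹) ^ (-(m : ℤ)) := fun z => by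
      rw [_root_.zpow_neg, zpow_natCast, inv_pow]
    simp only [h2]
    rw [circleIntegral.integral_sub_zpow_of_ne (by omega), mul_zero]

lemma circleIntegral_kernel {a R : ℝ} (hR : 0 < R) (haR : R < a) {l : ℂ} (hl0 : l ≠ 0)
    (hl : l⁻¹ ∈ ball (a : ℂ) R) (m p : ℕ) :
    ∮ z in C(a, R), z⁻¹ ^ (p + 1) * (1 - z * l)⁻¹ ^ (m + 1) =
      -(2 * Real.pi * I) * ((p + m).choose m * l ^ p) := by
  have hne : ∀ z ∈ sphere (a : ℂ) R, 1 - z * l ≠ 0 := by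
    intro z hz h
    rw [sub_eq_zero] at h
    rw [← eq_inv_of_mul_eq_one_left h.symm] at hl
    exact (ne_of_lt hl) hz
  have hz0 : ∀ z ∈ sphere (a : ℂ) R, z ≠ 0 := by
    rintro z hz rfl
    simpa using re_pos_of_mem_closedBall haR (sphere_subset_closedBall hz)
  have hrec : ∀ m p : ℕ, ∮ z in C(a, R), z⁻¹ ^ (p + 1) * (1 - z * l)⁻¹ ^ (m + 1) =
      (∮ z in C(a, R), z⁻¹ ^ (p + 1) * (1 - z * l)⁻¹ ^ m) +
        l * ∮ z in C(a, R), z⁻¹ ^ p * (1 - z * l)⁻¹ ^ (m + 1) := by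
    intro m p
    rw [← circleIntegral.integral_const_mul, ← circleIntegral.integral_add
      (circleIntegrable_kernel hR haR hne _ _)
      (by simpa only [smul_eq_mul] using
        (circleIntegrable_kernel hR haR hne (m + 1) p).const_fun_smul (a := l))]
    refine circleIntegral.integral_congr hR.le fun z hz => ?_
    have := hne z hz
    have := hz0 z hz
    simp only [pow_succ, inv_pow]
    field_simp
    ring
  have hm0 : ∀ p : ℕ, ∮ z in C(a, R), z⁻¹ ^ p * (1 - z * l)⁻¹ ^ 0 = 0 := by
    intro p
    have := circleIntegral_eq_zero_of_no_pole hR haR (l := 0) (by simp) 0 p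
    simpa using this
  have hp0 : ∀ m : ℕ, ∮ z in C(a, R), z⁻¹ ^ 0 * (1 - z * l)⁻¹ ^ m =
      if m = 1 then -(2 * Real.pi * I) * l⁻¹ else 0 := by
    intro m
    simpa using circleIntegral_kernel_zero hl0 hl m
  induction p generalizing m with
  | zero =>
    induction m with
    | zero =>
      rw [hrec, hm0, hp0, if_pos rfl]
      field_simp
      simp
    | succ m ih =>
      rw [hrec, ih, hp0, if_neg (by omega)]
      simp
  | succ p ihp =>
    induction m with
    | zero =>
      rw [hrec, hm0, ihp]
      simp
      ring
    | succ m ihm =>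
      rw [hrec, ihm, ihp, show p + 1 + (m + 1) = (p + m + 1) + 1 by ring,
        Nat.choose_succ_succ, show p + 1 + m = p + m + 1 by ring,
        show p + (m + 1) = p + m + 1 by ring]
      push_cast
      ring

/-- The piecewise polynomial built from the partial fraction coefficients of
`tr ([(diag d - u)⁻¹ B]^(k + 2))` has non-negative real part. -/
lemma spline_re_nonneg {d : ι → ℝ} {B : Matrix ι ι ℂ} (hB : B.PosSemidef)
    (hB' : (1 - B).PosSemidef) {k : ℕ} {s : ι → ℂ} {ρ : ι → Fin (k + 1) → ℂ}
    (h : ∀ u : ℂ, (∀ i, (d i : ℂ) - u ≠ 0) →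
      ((diagonal (fun i => ((d i : ℂ) - u)⁻¹) * B) ^ (k + 2)).trace =
        ∑ i, (s i * ((d i : ℂ) - u)⁻¹ ^ (k + 2) +
          ∑ m, ρ i m * ((d i : ℂ) - u)⁻¹ ^ (m + 1 : ℕ)))
    {c : ℝ} (hc : ∀ i, d i ≠ c) :
    0 ≤ (∑ i, if d i < c then
      ∑ m, ρ i m * (k.choose m * ((c - d i : ℝ) : ℂ) ^ (k - m : ℕ)) else 0).re := by
  set l : ι → ℝ := fun i => c - d i with hl
  have hl0 : ∀ i, (l i : ℂ) ≠ 0 := fun i => ofReal_ne_zero.2 (sub_ne_zero.2 (hc i).symm)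
  set D : Matrix ι ι ℂ := diagonal fun i => (l i : ℂ) with hD
  have hDH : D.IsHermitian := by
    rw [hD, IsHermitian, diagonal_conjTranspose]
    congr 1
    ext i
    simp
  have hDu : IsUnit D := by
    rw [Matrix.isUnit_iff_isUnit_det, hD, det_diagonal]
    exact isUnit_iff_ne_zero.2 (Finset.prod_ne_zero_iff.2 fun i _ => hl0 i)
  obtain ⟨a, R, hR, haR, henc, hre⟩ :=
    exists_circle_integral_re_nonpos hDH hDu hB hB' (k := k + 2) (by omega)
  have hroot : ∀ i, D⁻¹.charpoly.IsRoot (l i : ℂ)⁻¹ := by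
    intro i
    have h1 : ((l i : ℂ)⁻¹ • (1 : Matrix ι ι ℂ) - D⁻¹).det * D.det = 0 := by
      rw [← det_mul, sub_mul, Matrix.nonsing_inv_mul _ ((Matrix.isUnit_iff_isUnit_det _).1 hDu),
        smul_mul_assoc, one_mul, hD, ← diagonal_smul, ← diagonal_one, diagonal_sub, det_diagonal]
      exact Finset.prod_eq_zero (Finset.mem_univ i) (by simp [hl0 i])
    rw [Polynomial.IsRoot.def, eval_charpoly_eq]
    exact (mul_eq_zero.1 h1).resolve_right
      (isUnit_iff_ne_zero.1 ((Matrix.isUnit_iff_isUnit_det _).1 hDu))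
  have hne : ∀ z ∈ sphere (a : ℂ) R, ∀ i, 1 - z * l i ≠ 0 := by
    intro z hz i h0
    refine henc.not_isRoot haR hz ?_
    rw [eq_inv_of_mul_eq_one_left (sub_eq_zero.1 h0).symm]
    exact hroot i
  have hz0 : ∀ z ∈ sphere (a : ℂ) R, z ≠ 0 := by
    rintro z hz rfl
    simpa using re_pos_of_mem_closedBall haR (sphere_subset_closedBall hz)
  have hpt : ∀ z ∈ sphere (a : ℂ) R, (((1 - z • D)⁻¹ * B) ^ (k + 2)).trace =
      ∑ i, (s i * (z⁻¹ ^ 0 * (1 - z * l i)⁻¹ ^ (k + 2)) +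
        ∑ m : Fin (k + 1), ρ i m * (z⁻¹ ^ (k - m + 1 : ℕ) * (1 - z * l i)⁻¹ ^ (m + 1 : ℕ))) := by
    intro z hz
    have hz' := hz0 z hz
    have hu : ∀ i, (d i : ℂ) - (c - z⁻¹) = z⁻¹ * (1 - z * l i) := by
      intro i
      simp only [hl]
      push_cast
      field_simp
      ring
    have e1 : (1 - z • D)⁻¹ = z⁻¹ • diagonal fun i => ((d i : ℂ) - (c - z⁻¹))⁻¹ := by
      refine Matrix.inv_eq_right_inv ?_
      rw [hD, ← diagonal_smul, ← diagonal_smul, ← diagonal_one, diagonal_sub, diagonal_mul_diagonal]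
      congr 1
      ext i
      have := hne z hz i
      simp only [Pi.smul_apply, hu, smul_eq_mul]
      field_simp
    rw [e1, smul_mul_assoc, _root_.smul_pow, trace_smul, h (c - z⁻¹) fun i => by
      rw [hu]; exact mul_ne_zero (inv_ne_zero hz') (hne z hz i)]
    rw [Finset.smul_sum]
    refine Finset.sum_congr rfl fun i _ => ?_
    rw [smul_add, Finset.smul_sum]
    congr 1
    · rw [hu, mul_inv, inv_inv, mul_pow, smul_eq_mul, inv_pow]
      field_simp
    · refine Finset.sum_congr rfl fun m _ => ?_
      rw [hu, mul_inv, inv_inv, mul_pow, smul_eq_mul, show k + 2 = (k - m + 1) + (m + 1) by omega,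
        pow_add z⁻¹, inv_pow z (m + 1)]
      field_simp
  have hint : (2 * Real.pi * I)⁻¹ *
      (∮ z in C(a, R), (((1 - z • D)⁻¹ * B) ^ (k + 2)).trace) =
      -∑ i, if d i < c then
        ∑ m : Fin (k + 1), ρ i m * (k.choose m * (l i : ℂ) ^ (k - m : ℕ)) else 0 := by
    have hk : ∀ (i : ι) (x : ℂ) (m p : ℕ),
        CircleIntegrable (fun z => x * (z⁻¹ ^ p * (1 - z * l i)⁻¹ ^ m)) a R := fun i x m p => by
      simpa only [smul_eq_mul] using
        (circleIntegrable_kernel hR haR (fun z hz => hne z hz i) m p).const_fun_smul (a := x)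
    have hks : ∀ i, CircleIntegrable (fun z => ∑ m : Fin (k + 1),
        ρ i m * (z⁻¹ ^ (k - m + 1 : ℕ) * (1 - z * l i)⁻¹ ^ (m + 1 : ℕ))) a R := fun i =>
      CircleIntegrable.fun_sum _ fun m _ => hk i _ _ _
    rw [circleIntegral.integral_congr hR.le hpt, circleIntegral.integral_fun_sum, Finset.mul_sum,
      ← Finset.sum_neg_distrib]
    · refine Finset.sum_congr rfl fun i _ => ?_
      rw [circleIntegral.integral_add, circleIntegral.integral_fun_sum]
      · simp only [circleIntegral.integral_const_mul]
        split_ifs with hi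
        · have hlpos : 0 < l i := sub_pos.2 hi
          have hmem : (l i : ℂ)⁻¹ ∈ ball (a : ℂ) R := by
            refine henc.mem_ball _ (hroot i) ?_
            rw [← ofReal_inv, ofReal_re]
            exact inv_pos.2 hlpos
          have h0 : ∮ z in C(a, R), z⁻¹ ^ 0 * (1 - z * l i)⁻¹ ^ (k + 2) = 0 := by
            simpa using circleIntegral_kernel_zero (hl0 i) hmem (k + 2)
          rw [h0, mul_zero, zero_add, Finset.mul_sum, ← Finset.sum_neg_distrib]
          refine Finset.sum_congr rfl fun m _ => ?_
          rw [circleIntegral_kernel hR haR (hl0 i) hmem, Nat.sub_add_cancel (by omega)]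
          have := Complex.two_pi_I_ne_zero
          field_simp
        · have hlneg : l i < 0 := sub_neg.2 (lt_of_le_of_ne (not_lt.1 hi) (hc i).symm)
          have hno : ∀ z ∈ closedBall (a : ℂ) R, 1 - z * (l i : ℂ) ≠ 0 := by
            intro z hz h0
            have h1 := re_pos_of_mem_closedBall haR hz
            have h2 := congrArg re h0
            simp at h2
            nlinarith
          simp only [circleIntegral_eq_zero_of_no_pole hR haR hno, mul_zero,
            Finset.sum_const_zero, add_zero, neg_zero]
      · exact fun m _ => hk i _ _ _
      · exact hk i _ _ _
      · exact hks i
    · exact fun i _ => (hk i _ _ _).add (hks i)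
  rw [hint, neg_re] at hre
  exact neg_nonpos.1 hre

open MeasureTheory in
/-- The Beta integral in the form `∫_α^∞ (c - α)^a c^(-a-b-2) dc`. -/
lemma beta_integral {α : ℝ} (hα : 0 < α) (a b : ℕ) :
    IntegrableOn (fun c : ℝ => (c - α) ^ a * c⁻¹ ^ (a + b + 2)) (Set.Ioi α) ∧
    ∫ c in Set.Ioi α, (c - α) ^ a * c⁻¹ ^ (a + b + 2) =
      α⁻¹ ^ (b + 1) * (a.factorial * b.factorial / (a + b + 1).factorial) := by
  induction a generalizing b with
  | zero =>
    have hb : (-(b + 2 : ℝ)) < -1 := by linarith [(Nat.cast_nonneg b : (0 : ℝ) ≤ b)]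
    have he : Set.EqOn (fun c : ℝ => (c - α) ^ 0 * c⁻¹ ^ (0 + b + 2)) (fun c => c ^ (-(b + 2 : ℝ)))
        (Set.Ioi α) := by
      intro c hc
      have hc0 : 0 < c := hα.trans hc
      simp only [pow_zero, one_mul, zero_add]
      rw [Real.rpow_neg hc0.le, inv_pow, ← Real.rpow_natCast]
      push_cast
      rfl
    refine ⟨(integrableOn_Ioi_rpow_of_lt hb hα).congr_fun he.symm measurableSet_Ioi, ?_⟩
    rw [setIntegral_congr_fun measurableSet_Ioi he, integral_Ioi_rpow_of_lt hb hα]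
    have h1 : -(b + 2 : ℝ) + 1 = -((b + 1 : ℕ) : ℝ) := by push_cast; ring
    rw [h1, Real.rpow_neg hα.le, Real.rpow_natCast, zero_add, Nat.factorial_succ, inv_pow]
    have := Nat.factorial_ne_zero b
    push_cast
    field_simp
    simp
  | succ a ih =>
    obtain ⟨i1, e1⟩ := ih b
    obtain ⟨i2, e2⟩ := ih (b + 1)
    have he : Set.EqOn (fun c : ℝ => (c - α) ^ (a + 1) * c⁻¹ ^ (a + 1 + b + 2))
        (fun c => (c - α) ^ a * c⁻¹ ^ (a + b + 2) -
          α * ((c - α) ^ a * c⁻¹ ^ (a + (b + 1) + 2))) (Set.Ioi α) := by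
      intro c hc
      have hc0 : c ≠ 0 := (hα.trans hc).ne'
      rw [show a + 1 + b + 2 = a + b + 2 + 1 by ring, show a + (b + 1) + 2 = a + b + 2 + 1 by ring]
      simp only [pow_succ _ (a + b + 2), pow_succ _ a]
      field_simp
    refine ⟨(i1.sub (i2.const_mul α)).congr_fun he.symm measurableSet_Ioi, ?_⟩
    rw [setIntegral_congr_fun measurableSet_Ioi he, integral_sub i1 (i2.const_mul α),
      integral_const_mul, e1, e2, show a + (b + 1) + 1 = a + b + 1 + 1 by ring,
      show a + 1 + b + 1 = a + b + 1 + 1 by ring, Nat.factorial_succ (a + b + 1),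
      Nat.factorial_succ a, Nat.factorial_succ b, pow_succ α⁻¹ (b + 1)]
    have := Nat.factorial_ne_zero (a + b + 1)
    push_cast
    field_simp
    ring

open MeasureTheory in
/-- Integrating a non-negative spline against `c^(-k-q-2)`. -/
lemma sum_re_nonneg_of_spline {ι : Type*} [Fintype ι] {d : ι → ℝ} (hd : ∀ i, 0 < d i) {k : ℕ}
    {ρ : ι → Fin (k + 1) → ℂ}
    (hT : ∀ c : ℝ, (∀ i, d i ≠ c) → 0 ≤ (∑ i, if d i < c then
      ∑ m, ρ i m * (k.choose m * ((c - d i : ℝ) : ℂ) ^ (k - m : ℕ)) else 0).re) (q : ℕ) :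
    0 ≤ (∑ i, ∑ m, ρ i m * ((m + q : ℕ).choose q * (d i : ℂ)⁻¹ ^ (m + q + 1 : ℕ))).re := by
  set f : ι → ℝ → ℝ := fun i c => ∑ m : Fin (k + 1), ((ρ i m).re * k.choose m) *
    ((c - d i) ^ (k - m : ℕ) * c⁻¹ ^ ((k - m) + (m + q) + 2 : ℕ)) with hf
  have hfi : ∀ i, IntegrableOn (f i) (Set.Ioi (d i)) := fun i =>
    integrable_finsetSum _ fun m _ => (beta_integral (hd i) _ _).1.const_mul _
  have hint : ∫ c, ∑ i, (Set.Ioi (d i)).indicator (f i) c =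
      (k.factorial * q.factorial / (k + q + 1).factorial) *
        (∑ i, ∑ m, ρ i m * ((m + q : ℕ).choose q * (d i : ℂ)⁻¹ ^ (m + q + 1 : ℕ))).re := by
    rw [integral_finsetSum _ fun i _ => (hfi i).integrable_indicator measurableSet_Ioi, re_sum,
      Finset.mul_sum]
    refine Finset.sum_congr rfl fun i _ => ?_
    rw [integral_indicator measurableSet_Ioi, hf, integral_finsetSum _ fun m _ =>
      (beta_integral (hd i) _ _).1.const_mul _, re_sum, Finset.mul_sum]
    refine Finset.sum_congr rfl fun m _ => ?_
    have hm : (m : ℕ) ≤ k := by omega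
    rw [integral_const_mul, (beta_integral (hd i) _ _).2]
    have e : ((m + q : ℕ).choose q * (d i : ℂ)⁻¹ ^ (m + q + 1 : ℕ) : ℂ) =
        (((m + q : ℕ).choose q * (d i)⁻¹ ^ (m + q + 1 : ℕ) : ℝ) : ℂ) := by push_cast; rfl
    rw [e, re_mul_ofReal, Nat.cast_choose ℝ hm, Nat.cast_choose ℝ (Nat.le_add_left q m),
      Nat.add_sub_cancel, show k - m + (m + q) + 1 = k + q + 1 by omega]
    have := Nat.factorial_ne_zero (k - m)
    have := Nat.factorial_ne_zero (m : ℕ)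
    have := Nat.factorial_ne_zero (k + q + 1)
    have := Nat.factorial_ne_zero q
    field_simp
  have hnn : 0 ≤ ∫ c, ∑ i, (Set.Ioi (d i)).indicator (f i) c := by
    refine integral_nonneg_of_ae ?_
    filter_upwards [(Set.countable_range d).ae_notMem volume] with c hc
    rcases le_or_gt c 0 with hc0 | hc0
    · refine (Finset.sum_eq_zero fun i _ => Set.indicator_of_notMem ?_ _).ge
      exact fun h => absurd (lt_of_lt_of_le h hc0) (hd i).not_gt
    · have h1 := hT c fun i hi => hc ⟨i, hi⟩
      have h2 : ∑ i, (Set.Ioi (d i)).indicator (f i) c = c⁻¹ ^ (k + q + 2) *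
          (∑ i, if d i < c then
            ∑ m, ρ i m * (k.choose m * ((c - d i : ℝ) : ℂ) ^ (k - m : ℕ)) else 0).re := by
        rw [re_sum, Finset.mul_sum]
        refine Finset.sum_congr rfl fun i _ => ?_
        rw [Set.indicator_apply]
        simp only [Set.mem_Ioi]
        split_ifs with hi
        · rw [re_sum, Finset.mul_sum]
          refine Finset.sum_congr rfl fun m _ => ?_
          have e : (k.choose m * ((c - d i : ℝ) : ℂ) ^ (k - m : ℕ) : ℂ) =
            ((k.choose m * (c - d i) ^ (k - m : ℕ) : ℝ) : ℂ) := by push_cast; rfl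
          rw [e, re_mul_ofReal, show k - m + (m + q) + 2 = k + q + 2 by omega]
          ring
        · simp
      rw [Pi.zero_apply, h2]
      positivity
  rw [hint] at hnn
  exact nonneg_of_mul_nonneg_right hnn (by positivity)

lemma map_trace_diagonal_mul_pow {R S : Type*} [CommRing R] [Algebra ℂ R] [CommRing S]
    [Algebra ℂ S] (f : R →ₐ[ℂ] S) (y : ι → R) (B : Matrix ι ι ℂ) (k : ℕ) :
    f ((diagonal y * B.map (algebraMap ℂ R)) ^ k).trace =
      ((diagonal (fun i => f (y i)) * B.map (algebraMap ℂ S)) ^ k).trace := by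
  have h := AddMonoidHom.map_trace f.toRingHom.toAddMonoidHom
    ((diagonal y * B.map (algebraMap ℂ R)) ^ k)
  refine h.trans (congrArg trace ?_)
  change f.toRingHom.mapMatrix _ = _
  rw [map_pow, map_mul]
  congr 2
  · ext i j
    by_cases hij : i = j <;> simp [hij]
  · ext i j
    simp

/-- The power series `∑ q, α^(-q-1) X^q` of `(α - X)⁻¹`. -/
noncomputable def fractionSeries (α : ℂ) : PowerSeries ℂ := PowerSeries.mk fun q => α⁻¹ ^ (q + 1)

lemma fractionSeries_mul {α : ℂ} (hα : α ≠ 0) :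
    (PowerSeries.C α - PowerSeries.X) * fractionSeries α = 1 := by
  ext q
  rcases q with _ | q
  · simp [fractionSeries, sub_mul, hα]
  · rw [sub_mul, map_sub, PowerSeries.coeff_C_mul, PowerSeries.coeff_succ_X_mul]
    simp only [fractionSeries, PowerSeries.coeff_mk, PowerSeries.coeff_one]
    rw [pow_succ' _ (q + 1), mul_inv_cancel_left₀ hα]
    simp

lemma fractionSeries_sub {α β : ℂ} (hα : α ≠ 0) (hβ : β ≠ 0) :
    fractionSeries α - fractionSeries β =
      (β - α) • (fractionSeries α * fractionSeries β) := by
  have h1 := fractionSeries_mul hα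
  have h2 := fractionSeries_mul hβ
  rw [PowerSeries.smul_eq_C_mul, map_sub]
  linear_combination fractionSeries β * h1 - fractionSeries α * h2

lemma coeff_fractionSeries_pow (α : ℂ) (m q : ℕ) :
    PowerSeries.coeff q (fractionSeries α ^ (m + 1)) =
      (m + q).choose q * α⁻¹ ^ (m + q + 1) := by
  have h : fractionSeries α = PowerSeries.C α⁻¹ * PowerSeries.rescale α⁻¹ (PowerSeries.mk 1) := by
    ext q
    simp [fractionSeries, pow_succ']
  rw [h, mul_pow, ← map_pow, ← map_pow, PowerSeries.coeff_C_mul, PowerSeries.coeff_rescale,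
    PowerSeries.mk_one_pow_eq_mk_choose_add, PowerSeries.coeff_mk, Nat.choose_symm_add]
  ring

/-- Positivity of the Taylor coefficients of `tr ([(diag d - u)⁻¹ B]^k)` at `u = 0`
for a contraction `B`. -/
lemma coeff_trace_diagonal_re_nonneg_of_le_one {d : ι → ℝ} (hd : ∀ i, 0 < d i)
    {B : Matrix ι ι ℂ} (hB : B.PosSemidef) (hB' : (1 - B).PosSemidef) (k q : ℕ) :
    0 ≤ (PowerSeries.coeff q ((diagonal (fun i => fractionSeries (d i)) *
      B.map PowerSeries.C) ^ (k + 2)).trace).re := by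
  have hd0 : ∀ i, (d i : ℂ) ≠ 0 := fun i => ofReal_ne_zero.2 (hd i).ne'
  set y : ι → PowerSeries ℂ × ({u : ℂ // ∀ i, (d i : ℂ) - u ≠ 0} → ℂ) := fun i =>
    (fractionSeries (d i), fun u => ((d i : ℂ) - u)⁻¹) with hy
  have hyy : ∀ i j, y i - y j = ((d j : ℂ) - d i) • (y i * y j) := by
    intro i j
    refine Prod.ext (fractionSeries_sub (hd0 i) (hd0 j)) (funext fun u => ?_)
    have := u.2 i
    have := u.2 j
    simp only [hy, Prod.snd_sub, Prod.smul_snd, Prod.snd_mul, Pi.sub_apply, Pi.smul_apply,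
      Pi.mul_apply, smul_eq_mul]
    field_simp
    ring
  obtain ⟨ρ, hρ⟩ := exists_partial_fractions (d := fun i => (d i : ℂ)) hyy B (k + 1)
  have hseries : ((diagonal (fun i => fractionSeries (d i)) *
      B.map PowerSeries.C) ^ (k + 2)).trace = ∑ i,
        (((levelProj (fun i => (d i : ℂ)) (d i) * B) ^ (k + 2)) i i •
          fractionSeries (d i) ^ (k + 2) + ∑ m, ρ i m • fractionSeries (d i) ^ (m + 1 : ℕ)) := by
    have h := congrArg (AlgHom.fst ℂ _ _) hρ
    rw [map_trace_diagonal_mul_pow] at h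
    simp only [map_add, map_sum, map_smul, map_pow] at h
    simpa [hy] using h
  have hfun : ∀ u : ℂ, (∀ i, (d i : ℂ) - u ≠ 0) →
      ((diagonal (fun i => ((d i : ℂ) - u)⁻¹) * B) ^ (k + 2)).trace = ∑ i,
        (((levelProj (fun i => (d i : ℂ)) (d i) * B) ^ (k + 2)) i i *
          ((d i : ℂ) - u)⁻¹ ^ (k + 2) + ∑ m, ρ i m * ((d i : ℂ) - u)⁻¹ ^ (m + 1 : ℕ)) := by
    intro u hu
    have h := congrArg ((Pi.evalAlgHom ℂ (fun _ => ℂ) ⟨u, hu⟩).comp (AlgHom.snd ℂ _ _)) hρ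
    rw [map_trace_diagonal_mul_pow] at h
    simp only [map_add, map_sum, map_smul, map_pow] at h
    simpa [hy] using h
  rw [hseries]
  simp only [map_sum, map_add, map_smul, smul_eq_mul, coeff_fractionSeries_pow]
  rw [Finset.sum_add_distrib, add_re]
  refine add_nonneg ?_ (sum_re_nonneg_of_spline hd
    (fun c hc => spline_re_nonneg hB hB' hfun hc) q)
  rw [re_sum]
  refine Finset.sum_nonneg fun i _ => ?_
  have e : ((k + 1 + q : ℕ).choose q * (d i : ℂ)⁻¹ ^ (k + 1 + q + 1 : ℕ) : ℂ) =
    (((k + 1 + q : ℕ).choose q * (d i)⁻¹ ^ (k + 1 + q + 1 : ℕ) : ℝ) : ℂ) := by push_cast; rfl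
  rw [e, re_mul_ofReal]
  have := hd i
  exact mul_nonneg (levelProj_mul_pow_apply_re_nonneg (fun i => (d i : ℂ)) hB (k + 2) i)
    (by positivity)

lemma conjTranspose_eigenvectorUnitary_mul {A : Matrix ι ι ℂ} (hA : A.IsHermitian) :
    (hA.eigenvectorUnitary : Matrix ι ι ℂ)ᴴ * hA.eigenvectorUnitary = 1 :=
  Unitary.coe_star_mul_self hA.eigenvectorUnitary

lemma eq_unitary_conj {A : Matrix ι ι ℂ} (hA : A.IsHermitian) :
    A = hA.eigenvectorUnitary * diagonal (fun i => (hA.eigenvalues i : ℂ)) *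
      (hA.eigenvectorUnitary : Matrix ι ι ℂ)ᴴ := by
  conv_lhs => rw [hA.spectral_theorem]
  rfl

lemma exists_one_sub_smul_posSemidef {B : Matrix ι ι ℂ} (hB : B.PosSemidef) :
    ∃ s : ℝ, 0 < s ∧ (1 - (s : ℂ) • B).PosSemidef := by
  set e := hB.1.eigenvalues with he
  have he0 : ∀ i, 0 ≤ e i := hB.eigenvalues_nonneg
  have hpos : 0 < 1 + ∑ i, e i := by
    have := Finset.sum_nonneg fun i (_ : i ∈ Finset.univ) => he0 i
    linarith
  refine ⟨(1 + ∑ i, e i)⁻¹, inv_pos.2 hpos, ?_⟩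
  set V : Matrix ι ι ℂ := hB.1.eigenvectorUnitary.1 with hV
  have hVV : V * Vᴴ = 1 := mul_eq_one_comm.1 (conjTranspose_eigenvectorUnitary_mul hB.1)
  have h1 : 1 - (((1 + ∑ i, e i)⁻¹ : ℝ) : ℂ) • B =
      V * diagonal (fun i => ((1 - (1 + ∑ i, e i)⁻¹ * e i : ℝ) : ℂ)) * Vᴴ := by
    have h2 : diagonal (fun i => ((1 - (1 + ∑ i, e i)⁻¹ * e i : ℝ) : ℂ)) =
        1 - (((1 + ∑ i, e i)⁻¹ : ℝ) : ℂ) • diagonal (fun i => (e i : ℂ)) := by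
      rw [← diagonal_smul, ← diagonal_one, diagonal_sub]
      congr 1
      ext i
      simp
    rw [h2, mul_sub, sub_mul, mul_one, hVV, Matrix.mul_smul, smul_mul_assoc, ← eq_unitary_conj hB.1]
  rw [h1]
  refine PosSemidef.mul_mul_conjTranspose_same (PosSemidef.diagonal fun i => ?_) V
  rw [Pi.zero_apply, zero_le_real, sub_nonneg, inv_mul_le_one₀ hpos]
  have := Finset.single_le_sum (fun i _ => he0 i) (Finset.mem_univ i)
  linarith

lemma coeff_trace_diagonal_re_nonneg {d : ι → ℝ} (hd : ∀ i, 0 < d i)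
    {B : Matrix ι ι ℂ} (hB : B.PosSemidef) (k q : ℕ) :
    0 ≤ (PowerSeries.coeff q ((diagonal (fun i => fractionSeries (d i)) *
      B.map PowerSeries.C) ^ (k + 2)).trace).re := by
  obtain ⟨s, hs, hs1⟩ := exists_one_sub_smul_posSemidef hB
  have h := coeff_trace_diagonal_re_nonneg_of_le_one hd
    (hB.smul (zero_le_real.2 hs.le)) hs1 k q
  have e : ((s : ℂ) • B).map PowerSeries.C = (s : ℂ) • B.map PowerSeries.C := by
    ext i j : 2
    simp [PowerSeries.smul_eq_C_mul]
  rw [e, Matrix.mul_smul, _root_.smul_pow, trace_smul, map_smul, smul_eq_mul, ← ofReal_pow,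
    re_ofReal_mul] at h
  exact nonneg_of_mul_nonneg_right h (by positivity)

/-- The series `∑ q, (X^(q+1) B) u^q`, which represents `(X⁻¹ - u)⁻¹ B`. -/
noncomputable def resolventSeries (X B : Matrix ι ι ℂ) : Matrix ι ι (PowerSeries ℂ) :=
  of fun i j => PowerSeries.mk fun q => (X ^ (q + 1) * B) i j

lemma coeff_resolventSeries_pow_trace_re_nonneg {A B : Matrix ι ι ℂ} (hA : A.PosDef)
    (hB : B.PosSemidef) (k q : ℕ) :
    0 ≤ (PowerSeries.coeff q ((resolventSeries A⁻¹ B) ^ (k + 2)).trace).re := by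
  set d := hA.1.eigenvalues with hd
  have hd0 : ∀ i, 0 < d i := hA.eigenvalues_pos
  set U : Matrix ι ι ℂ := hA.1.eigenvectorUnitary.1 with hU
  have hUU : Uᴴ * U = 1 := conjTranspose_eigenvectorUnitary_mul hA.1
  have hUU' : U * Uᴴ = 1 := mul_eq_one_comm.1 hUU
  have hAinv : A⁻¹ = U * diagonal (fun i => (d i : ℂ)⁻¹) * Uᴴ := by
    refine Matrix.inv_eq_right_inv ?_
    conv_lhs => rw [eq_unitary_conj hA.1]
    rw [← hU, ← hd, mul_assoc (U * _), mul_assoc U _ Uᴴ, ← mul_assoc Uᴴ, hUU, one_mul, mul_assoc U,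
      ← mul_assoc (diagonal _), diagonal_mul_diagonal]
    have : (fun i => (d i : ℂ) * (d i : ℂ)⁻¹) = fun _ => 1 := by
      ext i
      exact mul_inv_cancel₀ (ofReal_ne_zero.2 (hd0 i).ne')
    rw [this, diagonal_one, one_mul, hUU']
  have hpow : ∀ q : ℕ, A⁻¹ ^ q = U * diagonal (fun i => (d i : ℂ)⁻¹ ^ q) * Uᴴ := by
    intro q
    induction q with
    | zero => simp [hUU']
    | succ q ih =>
      rw [pow_succ, ih, hAinv, mul_assoc (U * _), mul_assoc U _ Uᴴ, ← mul_assoc Uᴴ, hUU, one_mul,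
        mul_assoc U, ← mul_assoc (diagonal _), diagonal_mul_diagonal, ← mul_assoc]
      rfl
  set Z := diagonal (fun i => fractionSeries (d i)) * (Uᴴ * B * U).map PowerSeries.C with hZ
  have hconj : resolventSeries A⁻¹ B * U.map PowerSeries.C = U.map PowerSeries.C * Z := by
    ext i j q
    rw [mul_apply, mul_apply, map_sum, map_sum]
    simp only [map_apply, PowerSeries.coeff_mul_C, PowerSeries.coeff_C_mul, hZ, diagonal_mul,
      resolventSeries, of_apply, PowerSeries.coeff_mk, fractionSeries]
    have h := congrFun (congrFun (show A⁻¹ ^ (q + 1) * B * U =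
      U * (diagonal (fun i => (d i : ℂ)⁻¹ ^ (q + 1)) * (Uᴴ * B * U)) by
        rw [hpow]; simp only [mul_assoc]) i) j
    rw [mul_apply, mul_apply] at h
    simpa only [diagonal_mul] using h
  have hCC : U.map PowerSeries.C * Uᴴ.map PowerSeries.C = 1 := by
    rw [← Matrix.map_mul, hUU', Matrix.map_one _ (map_zero _) (map_one _)]
  have hCC' : Uᴴ.map PowerSeries.C * U.map PowerSeries.C = 1 := mul_eq_one_comm.1 hCC
  have hpowconj : ∀ n : ℕ, resolventSeries A⁻¹ B ^ n * U.map PowerSeries.C =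
      U.map PowerSeries.C * Z ^ n := fun n =>
    ((show SemiconjBy (U.map PowerSeries.C) Z (resolventSeries A⁻¹ B) from
      hconj.symm).pow_right n).eq.symm
  have htr : (resolventSeries A⁻¹ B ^ (k + 2)).trace = (Z ^ (k + 2)).trace := by
    rw [← mul_one (resolventSeries A⁻¹ B ^ (k + 2)), ← hCC, ← mul_assoc, hpowconj, trace_mul_cycle,
      hCC', one_mul]
  rw [htr]
  exact coeff_trace_diagonal_re_nonneg hd0 (hB.conjTranspose_mul_mul_same U) k q

lemma hasDerivAt_inv_pow {A B : Matrix ι ι ℂ} {t : ℝ} (h : IsUnit (A + t • B)) (q : ℕ) :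
    HasDerivAt (fun t : ℝ => (A + t • B)⁻¹ ^ (q + 1))
      (-∑ x ∈ Finset.HasAntidiagonal.antidiagonal q,
        (A + t • B)⁻¹ ^ (x.1 + 1) * B * (A + t • B)⁻¹ ^ (x.2 + 1)) t := by
  have h1 : HasDerivAt (fun t : ℝ => A + t • B) B t :=
    (((hasDerivAt_id t).smul_const B).const_add A).congr_deriv (one_smul _ _)
  refine ((hasDerivAt_matrix_inv h1 h).fun_pow' (q + 1)).congr_deriv ?_
  rw [Finset.Nat.sum_antidiagonal_eq_sum_range_succ
    (fun a b => (A + t • B)⁻¹ ^ (a + 1) * B * (A + t • B)⁻¹ ^ (b + 1)), ← Finset.sum_neg_distrib,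
    ← Finset.sum_range_reflect]
  refine Finset.sum_congr rfl fun i hi => ?_
  have hi := Finset.mem_range.1 hi
  rw [mul_neg, neg_mul, pow_succ _ i, pow_succ' _ (q - i)]
  rw [show (q + 1).pred - (q + 1 - 1 - i) = i by simp only [Nat.pred_eq_sub_one]; omega,
    show q + 1 - 1 - i = q - i by omega]
  simp only [mul_assoc]

/-- Entry- and coefficientwise derivative of a family of matrices over power series. -/
def HasCoeffDerivAt (F : ℝ → Matrix ι ι (PowerSeries ℂ)) (F' : Matrix ι ι (PowerSeries ℂ))
    (t : ℝ) : Prop :=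
  ∀ i j q, HasDerivAt (fun t => PowerSeries.coeff q (F t i j)) (PowerSeries.coeff q (F' i j)) t

lemma HasCoeffDerivAt.mul {ι : Type*} [Fintype ι] {F G : ℝ → Matrix ι ι (PowerSeries ℂ)}
    {F' G' : Matrix ι ι (PowerSeries ℂ)} {t : ℝ} (hF : HasCoeffDerivAt F F' t)
    (hG : HasCoeffDerivAt G G' t) :
    HasCoeffDerivAt (fun t => F t * G t) (F' * G t + F t * G') t := by
  intro i j q
  simp only [mul_apply, Matrix.add_apply, map_add, map_sum, PowerSeries.coeff_mul,
    ← Finset.sum_add_distrib]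
  exact HasDerivAt.fun_sum fun l _ => HasDerivAt.fun_sum fun x _ =>
    (hF i l x.1).fun_mul (hG l j x.2)

lemma HasCoeffDerivAt.pow {F : ℝ → Matrix ι ι (PowerSeries ℂ)} {t : ℝ}
    (hF : HasCoeffDerivAt F (-(F t * F t)) t) (k : ℕ) :
    HasCoeffDerivAt (fun t => F t ^ k) (-(k • F t ^ (k + 1))) t := by
  induction k with
  | zero =>
    intro i j q
    simpa using hasDerivAt_const t _
  | succ k ih =>
    have h := ih.mul hF
    simp only [← pow_succ] at h
    convert h using 1
    rw [neg_mul, smul_mul_assoc, ← pow_succ, mul_neg, ← mul_assoc, ← pow_succ, ← pow_succ,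
      succ_nsmul]
    abel

lemma hasCoeffDerivAt_resolventSeries {A B : Matrix ι ι ℂ} {t : ℝ} (h : IsUnit (A + t • B)) :
    HasCoeffDerivAt (fun t : ℝ => resolventSeries (A + t • B)⁻¹ B)
      (-(resolventSeries (A + t • B)⁻¹ B * resolventSeries (A + t • B)⁻¹ B)) t := by
  intro i j q
  have h1 := hasDerivAt_pi.1 (hasDerivAt_pi.1 ((hasDerivAt_inv_pow h q).mul_const B) i) j
  simp only [resolventSeries, of_apply, PowerSeries.coeff_mk]
  refine h1.congr_deriv ?_
  rw [neg_mul, Matrix.neg_apply, Matrix.neg_apply, map_neg, Finset.sum_mul, Matrix.sum_apply,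
    mul_apply (M := of _), map_sum]
  simp only [PowerSeries.coeff_mul, of_apply, PowerSeries.coeff_mk]
  rw [Finset.sum_comm]
  congr 1
  refine Finset.sum_congr rfl fun x _ => ?_
  rw [mul_assoc, mul_apply]

lemma hasDerivAt_coeff_trace {A B : Matrix ι ι ℂ} {t : ℝ} (h : IsUnit (A + t • B)) (k q : ℕ) :
    HasDerivAt
      (fun t : ℝ => (PowerSeries.coeff q (resolventSeries (A + t • B)⁻¹ B ^ k).trace).re)
      (-(k * (PowerSeries.coeff q (resolventSeries (A + t • B)⁻¹ B ^ (k + 1)).trace).re)) t := by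
  have h1 := HasDerivAt.fun_sum fun i (_ : i ∈ Finset.univ) =>
    (hasCoeffDerivAt_resolventSeries h).pow k i i q
  have h2 := Complex.reCLM.hasFDerivAt.comp_hasDerivAt t h1
  simp only [trace, diag_apply, map_sum]
  refine h2.congr_deriv ?_
  rw [← map_sum, ← map_sum]
  simp only [Matrix.neg_apply, Matrix.smul_apply, map_neg, map_nsmul, Finset.sum_neg_distrib,
    ← Finset.smul_sum, reCLM_apply]
  rw [nsmul_eq_mul]

lemma hasDerivAt_trace_inv_pow {A B : Matrix ι ι ℂ} {t : ℝ} (h : IsUnit (A + t • B)) (p : ℕ) :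
    HasDerivAt (fun t : ℝ => ((A + t • B)⁻¹ ^ p).trace.re)
      (-(p * (PowerSeries.coeff p (resolventSeries (A + t • B)⁻¹ B).trace).re)) t := by
  have h0 : HasDerivAt (fun t : ℝ => A + t • B) B t :=
    (((hasDerivAt_id t).smul_const B).const_add A).congr_deriv (one_smul _ _)
  have h1 := hasDerivAt_trace_pow (hasDerivAt_matrix_inv h0 h) p
  refine (Complex.reCLM.hasFDerivAt.comp_hasDerivAt t h1).congr_deriv ?_
  rcases p with _ | p
  · simp
  · have e : PowerSeries.coeff (p + 1) (resolventSeries (A + t • B)⁻¹ B).trace =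
        ((A + t • B)⁻¹ ^ p * ((A + t • B)⁻¹ * B * (A + t • B)⁻¹)).trace := by
      rw [← mul_assoc, trace_mul_comm, ← mul_assoc, ← mul_assoc, ← pow_succ', ← pow_succ]
      simp [trace, resolventSeries]
    rw [e]
    simp

lemma iteratedDerivWithin_trace_inv_pow {A B : Matrix ι ι ℂ}
    (h : ∀ t : ℝ, 0 ≤ t → IsUnit (A + t • B)) {p : ℕ} {g : ℝ → ℝ}
    (hg : ∀ t : ℝ, 0 ≤ t → g t = ((A + t • B)⁻¹ ^ p).trace.re) (k : ℕ) {t : ℝ} (ht : 0 ≤ t) :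
    iteratedDerivWithin (k + 1) g (Set.Ici 0) t = (-1) ^ (k + 1) * (p * k.factorial *
      (PowerSeries.coeff p (resolventSeries (A + t • B)⁻¹ B ^ (k + 1)).trace).re) := by
  have hu : UniqueDiffWithinAt ℝ (Set.Ici 0) t := uniqueDiffOn_Ici 0 t ht
  induction k generalizing t with
  | zero =>
    rw [zero_add, iteratedDerivWithin_one]
    refine (((hasDerivAt_trace_inv_pow (h t ht) p).hasDerivWithinAt.congr (fun s hs => hg s hs)
      (hg t ht)).derivWithin hu).trans ?_
    simp
  | succ k ih =>
    rw [iteratedDerivWithin_succ]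
    refine (((((hasDerivAt_coeff_trace (h t ht) (k + 1) p).const_mul
      ((p : ℝ) * k.factorial)).const_mul
      ((-1 : ℝ) ^ (k + 1))).hasDerivWithinAt.congr (fun s hs => ih hs (uniqueDiffOn_Ici 0 s hs))
      (ih ht hu)).derivWithin hu).trans ?_
    rw [Nat.factorial_succ]
    push_cast
    ring

open scoped MatrixOrder in
lemma exists_eq_conjTranspose_mul_self {B : Matrix ι ι ℂ} (hB : B.PosSemidef) :
    ∃ C : Matrix ι ι ℂ, B = Cᴴ * C :=
  CStarAlgebra.nonneg_iff_eq_star_mul_self.1 hB.nonneg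

lemma re_nonneg_coeff_resolventSeries_trace {A B : Matrix ι ι ℂ} (hA : A.PosDef)
    (hB : B.PosSemidef) (q : ℕ) :
    0 ≤ (PowerSeries.coeff q (resolventSeries A⁻¹ B).trace).re := by
  have h : PowerSeries.coeff q (resolventSeries A⁻¹ B).trace = (A⁻¹ ^ (q + 1) * B).trace := by
    simp [trace, resolventSeries]
  obtain ⟨C, rfl⟩ := exists_eq_conjTranspose_mul_self hB
  rw [h, ← mul_assoc, trace_mul_comm, ← mul_assoc]
  exact (Complex.le_def.1
    ((hA.inv.posSemidef.pow (q + 1)).mul_mul_conjTranspose_same C).trace_nonneg).1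

end BMV

/-- For `A` positive definite and `B` positive semi-definite Hermitian matrices
and `p : ℕ`, the function `g(t) = Tr (((A + t • B)⁻¹) ^ p)` is completely
monotone on `[0, ∞)`: `(-1)^k * g^(k)(t) ≥ 0` for all `k` and all `t ≥ 0`. -/
theorem bmv_inverse_power_completely_monotone (n : ℕ) (p : ℕ)
    (A B : Matrix (Fin n) (Fin n) ℂ) (hA : A.PosDef) (hB : B.PosSemidef)
    (g : ℝ → ℝ)
    (hg : ∀ t : ℝ, 0 ≤ t → (g t : ℂ) = (((A + t • B)⁻¹) ^ p).trace) :
    ∀ (k : ℕ) (t : ℝ), 0 ≤ t →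
      0 ≤ (-1 : ℝ) ^ k * iteratedDerivWithin k g (Set.Ici 0) t := by
  intro k t ht
  have hpos : ∀ t : ℝ, 0 ≤ t → (A + t • B).PosDef := fun t ht => hA.add_posSemidef (hB.smul ht)
  have hg' : ∀ t : ℝ, 0 ≤ t → g t = ((A + t • B)⁻¹ ^ p).trace.re := fun t ht => by
    rw [← hg t ht, Complex.ofReal_re]
  rcases k with _ | k
  · rw [iteratedDerivWithin_zero, pow_zero, one_mul, hg' t ht]
    exact (Complex.le_def.1 ((hpos t ht).inv.posSemidef.pow p).trace_nonneg).1
  · rw [BMV.iteratedDerivWithin_trace_inv_pow (fun t ht => (hpos t ht).isUnit) hg' k ht,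
      ← mul_assoc, ← mul_pow, neg_one_mul, neg_neg, one_pow, one_mul]
    refine mul_nonneg (by positivity) ?_
    rcases k with _ | k
    · rw [zero_add, pow_one]
      exact BMV.re_nonneg_coeff_resolventSeries_trace (hpos t ht) hB p
    · exact BMV.coeff_resolventSeries_pow_trace_re_nonneg (hpos t ht) hB k p
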